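/- Let 0 < p < ∞, 0 < s < 2/p and 1/τ = s/2 + 1/p, and assume τ ≥ 1. There exists a constant c > 0, depending only on s, p and the structural parameters N₀, c₀, β, such that for every n ≥ n₀ and all S₁, S₂ ∈ S(n,1): |S₁|_{B^{s,1}_τ} ≤ |S₂|_{B^{s,1}_τ} + c · n^{s/2} · ‖S₁ − S₂‖_{L^p(Ω)}. -/

import Mathlib

open scoped Classical

open Set Metric MeasureTheory ENNReal

noncomputable section

/-- The Euclidean plane `ℝ²`. -/
abbrev Plane : Type := EuclideanSpace ℝ (Fin 2)

/-- `Q` is a compact regular convex set whose boundary is a polygon consisting of at most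
`N₀` line segments, with eccentricity bounded by `c₀`. -/
def IsRegularConvexPolygon (N₀ : ℕ) (c₀ : ℝ) (Q : Set Plane) : Prop :=
  IsCompact Q ∧ Convex ℝ Q ∧ Q.Nonempty ∧
    (∃ (m : ℕ) (v w : Fin m → Plane), m ≤ N₀ ∧ frontier Q = ⋃ i, segment ℝ (v i) (w i)) ∧
    (∃ (x₁ x₂ : Plane) (r₁ r₂ : ℝ), 0 < r₂ ∧
      closedBall x₂ r₂ ⊆ Q ∧ Q ⊆ closedBall x₁ r₁ ∧ r₁ ≤ c₀ * r₂)

/-- There is a triangle contained in `R` having the segment `[a,b]` as a side, whose two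
angles adjacent to that side are equal to `β`. -/
def HasGoodTriangle (β : ℝ) (R : Set Plane) (a b : Plane) : Prop :=
  ∃ c : Plane, convexHull ℝ {a, b, c} ⊆ R ∧
    EuclideanGeometry.angle b a c = β ∧ EuclideanGeometry.angle a b c = β

/-- `R ⊆ ℝ²` is a ring with structural parameters `N₀`, `c₀`, `β`: the difference of two
regular compact convex sets with polygonal boundaries, admitting no uncontrollably narrow
elongated subregions (each maximal edge of the boundary can be subdivided into at most two
segments, each carrying a good triangle with adjacent angles `β` inside `R`). -/
def IsRing (N₀ : ℕ) (c₀ β : ℝ) (R : Set Plane) : Prop :=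
  (∃ Q₁ Q₂ : Set Plane,
      IsRegularConvexPolygon N₀ c₀ Q₁ ∧
      (Q₂ = ∅ ∨ (Q₂ ⊆ Q₁ ∧ IsRegularConvexPolygon N₀ c₀ Q₂)) ∧
      R = Q₁ \ interior Q₂) ∧
  (∃ (m : ℕ) (v w : Fin m → Plane),
      frontier R = ⋃ i, segment ℝ (v i) (w i) ∧
      (∀ i, ∀ a b : Plane, segment ℝ (v i) (w i) ⊆ segment ℝ a b →
        segment ℝ a b ⊆ frontier R → segment ℝ a b = segment ℝ (v i) (w i)) ∧
      (∀ i, ∃ p ∈ segment ℝ (v i) (w i),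
        HasGoodTriangle β R (v i) p ∧ HasGoodTriangle β R p (w i)))

/-- `Ω` is the union of `n` rings with pairwise disjoint interiors. -/
def IsRingDecomp (N₀ : ℕ) (c₀ β : ℝ) (n : ℕ) (Ω : Set Plane) : Prop :=
  ∃ R : Fin n → Set Plane,
    (∀ j, IsRing N₀ c₀ β (R j)) ∧
    (∀ i j, i ≠ j → interior (R i) ∩ interior (R j) = ∅) ∧
    (⋃ j, R j) = Ω

/-- Membership in the nonlinear spline class `S(n,k)`: piecewise polynomials of total degree
`< k` over `n` rings with pairwise disjoint interiors whose union is `Ω` (or, when `Ω = ℝ²`,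
whose union -- the support of the spline -- is itself a ring), having maximum smoothness
`W^{k-2}(Ω)` when `k ≥ 2` (no smoothness is required for piecewise constants, `k = 1`). -/
def IsSpline (N₀ : ℕ) (c₀ β : ℝ) (n k : ℕ) (Ω : Set Plane) (S : Plane → ℝ) : Prop :=
  ∃ (R : Fin n → Set Plane) (P : Fin n → MvPolynomial (Fin 2) ℝ),
    (∀ j, IsRing N₀ c₀ β (R j)) ∧
    (∀ i j, i ≠ j → interior (R i) ∩ interior (R j) = ∅) ∧
    ((⋃ j, R j) = Ω ∨ (Ω = Set.univ ∧ IsRing N₀ c₀ β (⋃ j, R j))) ∧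
    (∀ j, (P j).totalDegree < k) ∧
    (S = fun x => ∑ j, (R j).indicator (fun y => MvPolynomial.eval (fun i => y i) (P j)) x) ∧
    (2 ≤ k → ContDiffOn ℝ ((k - 2 : ℕ) : ℕ∞) S Ω)

/-- The spline class `S(n,k,r)` with defect: smoothness `W^r(Ω)` instead of the maximal
smoothness `W^{k-2}(Ω)`. -/
def IsSplineDefect (N₀ : ℕ) (c₀ β : ℝ) (n k r : ℕ) (Ω : Set Plane) (S : Plane → ℝ) : Prop :=
  ∃ (R : Fin n → Set Plane) (P : Fin n → MvPolynomial (Fin 2) ℝ),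
    (∀ j, IsRing N₀ c₀ β (R j)) ∧
    (∀ i j, i ≠ j → interior (R i) ∩ interior (R j) = ∅) ∧
    ((⋃ j, R j) = Ω ∨ (Ω = Set.univ ∧ IsRing N₀ c₀ β (⋃ j, R j))) ∧
    (∀ j, (P j).totalDegree < k) ∧
    (S = fun x => ∑ j, (R j).indicator (fun y => MvPolynomial.eval (fun i => y i) (P j)) x) ∧
    ContDiffOn ℝ ((r : ℕ) : ℕ∞) S Ω

/-- The `L^p(Ω)` quasi-norm, `0 < p < ∞`. -/
def lpNormE (p : ℝ) (Ω : Set Plane) (f : Plane → ℝ) : ℝ≥0∞ :=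
  eLpNorm f (ENNReal.ofReal p) (volume.restrict Ω)

/-- `k`-th finite difference `Δ_h^k f(x)`, set to `0` unless the segment `[x, x+kh] ⊆ Ω`. -/
def deltah (Ω : Set Plane) (k : ℕ) (h : Plane) (f : Plane → ℝ) (x : Plane) : ℝ :=
  if segment ℝ x (x + (k : ℝ) • h) ⊆ Ω then
    ∑ ν ∈ Finset.range (k + 1), (-1 : ℝ) ^ (k + ν) * (k.choose ν : ℝ) * f (x + (ν : ℝ) • h)
  else 0

/-- Modulus of smoothness `ω_k(f,t)_τ = sup_{|h| ≤ t} ‖Δ_h^k f‖_{L^τ(Ω)}`. -/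
def modulus (Ω : Set Plane) (k : ℕ) (τ : ℝ) (f : Plane → ℝ) (t : ℝ) : ℝ≥0∞ :=
  ⨆ (h : Plane) (_ : ‖h‖ ≤ t), lpNormE τ Ω (deltah Ω k h f)

/-- Besov seminorm `|f|_{B^{s,k}_τ} = (∫₀^∞ [t^{-s} ω_k(f,t)_τ]^τ dt/t)^{1/τ}`. -/
def besovSeminorm (Ω : Set Plane) (k : ℕ) (s τ : ℝ) (f : Plane → ℝ) : ℝ≥0∞ :=
  (∫⁻ t in Set.Ioi (0 : ℝ),
      (ENNReal.ofReal (t ^ (-s)) * modulus Ω k τ f t) ^ τ / ENNReal.ofReal t) ^ (1 / τ)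

/-- Error of best `L^p(Ω)`-approximation `S_n^k(f)_p` from the spline class `S(n,k)`. -/
def splineApprox (N₀ : ℕ) (c₀ β : ℝ) (n k : ℕ) (p : ℝ) (Ω : Set Plane) (f : Plane → ℝ) :
    ℝ≥0∞ :=
  ⨅ (S : Plane → ℝ) (_ : IsSpline N₀ c₀ β n k Ω S), lpNormE p Ω fun x => f x - S x

/-- The K-functional `K(f,t; L^p(Ω), B^{s,k}_τ)`. -/
def kFunctional (Ω : Set Plane) (k : ℕ) (s τ p : ℝ) (f : Plane → ℝ) (t : ℝ) : ℝ≥0∞ :=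
  ⨅ g : Plane → ℝ,
    lpNormE p Ω (fun x => f x - g x) + ENNReal.ofReal t * besovSeminorm Ω k s τ g

/-- BV seminorm: the total mass of the distributional gradient of `g` on `Ω`, defined by
duality against compactly supported `C¹` vector fields of norm at most one. -/
def bvSeminorm (Ω : Set Plane) (g : Plane → ℝ) : ℝ≥0∞ :=
  ⨆ (φ : Plane → Plane) (_ : ContDiff ℝ 1 φ ∧ HasCompactSupport φ ∧
      tsupport φ ⊆ interior Ω ∧ ∀ x, ‖φ x‖ ≤ 1),
    ENNReal.ofReal (∫ x in Ω, g x * ∑ i, fderiv ℝ φ x (EuclideanSpace.single i 1) i)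

/-- The K-functional `K(f,t; L²(Ω), BV(Ω))`. -/
def kFunctionalBV (Ω : Set Plane) (f : Plane → ℝ) (t : ℝ) : ℝ≥0∞ :=
  ⨅ g : Plane → ℝ,
    lpNormE 2 Ω (fun x => f x - g x) + ENNReal.ofReal t * bvSeminorm Ω g

/-- The aperture of the half-discs fitting under a triangle with base angles `β`. -/
def aperture (β : ℝ) : ℝ := Real.tan β / (1 + Real.tan β)

lemma tan_pos_of_le_pi_div_three {β : ℝ} (hβ : 0 < β) (hβ' : β ≤ Real.pi / 3) :
    0 < Real.tan β :=
  Real.tan_pos_of_pos_of_lt_pi_div_two hβ (by linarith [Real.pi_pos])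

lemma aperture_pos {β : ℝ} (hβ : 0 < β) (hβ' : β ≤ Real.pi / 3) : 0 < aperture β := by
  have := tan_pos_of_le_pi_div_three hβ hβ'
  unfold aperture; positivity

lemma aperture_lt_one {β : ℝ} (hβ : 0 < β) (hβ' : β ≤ Real.pi / 3) : aperture β < 1 := by
  have := tan_pos_of_le_pi_div_three hβ hβ'
  unfold aperture
  rw [div_lt_one (by linarith)]; linarith

lemma HasGoodTriangle.ne {β : ℝ} (hβ' : β ≤ Real.pi / 3) {R : Set Plane}
    {a b : Plane} (H : HasGoodTriangle β R a b) : a ≠ b := by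
  rintro rfl
  obtain ⟨c, -, h1, -⟩ := H
  rw [EuclideanGeometry.angle_self_left] at h1
  linarith [Real.pi_pos]

lemma eq_add_of_inner_eq_zero {e n : Plane} (he : e ≠ 0) (hn : n ≠ 0) (hen : inner ℝ e n = 0)
    (h : Plane) :
    h = (inner ℝ e h / ‖e‖ ^ 2) • e + (inner ℝ n h / ‖n‖ ^ 2) • n := by
  have he0 : ‖e‖ ≠ 0 := norm_ne_zero_iff.2 he
  have hn0 : ‖n‖ ≠ 0 := norm_ne_zero_iff.2 hn
  have hne : inner ℝ n e = 0 := by rw [real_inner_comm]; exact hen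
  have hon : Orthonormal ℝ ![(‖e‖⁻¹ : ℝ) • e, (‖n‖⁻¹ : ℝ) • n] := by
    constructor
    · intro i
      fin_cases i
      · simp [norm_smul, he0]
      · simp [norm_smul, hn0]
    · intro i j hij
      fin_cases i <;> fin_cases j <;> simp_all [inner_smul_left, inner_smul_right]
  obtain ⟨B, hB⟩ := Orthonormal.exists_orthonormalBasis_extension_of_card_eq
    (𝕜 := ℝ) (E := Plane) (ι := Fin 2) (by simp) (v := ![(‖e‖⁻¹ : ℝ) • e, (‖n‖⁻¹ : ℝ) • n])
    (s := Set.univ) (hon.comp _ Subtype.val_injective)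
  have hB0 : B 0 = (‖e‖⁻¹ : ℝ) • e := hB 0 (Set.mem_univ _)
  have hB1 : B 1 = (‖n‖⁻¹ : ℝ) • n := hB 1 (Set.mem_univ _)
  have hdec := B.sum_repr' h
  rw [Fin.sum_univ_two, hB0, hB1, inner_smul_left, inner_smul_left, smul_smul, smul_smul] at hdec
  conv_lhs => rw [← hdec]
  simp only [conj_trivial]
  congr 2 <;> field_simp

lemma convex_combo_three {K : Set Plane} (hK : Convex ℝ K) {a b c : Plane} (ha : a ∈ K)
    (hb : b ∈ K) (hc : c ∈ K) {r s t : ℝ} (hr : 0 ≤ r) (hs : 0 ≤ s) (ht : 0 ≤ t)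
    (h : r + s + t = 1) : r • a + s • b + t • c ∈ K := by
  have hmem := hK.sum_mem (t := Finset.univ) (w := ![r, s, t]) (z := ![a, b, c])
    (by intro i _; fin_cases i <;> simp [hr, hs, ht])
    (by rw [Fin.sum_univ_three]; simpa using h)
    (by intro i _; fin_cases i <;> simp [ha, hb, hc])
  rw [Fin.sum_univ_three] at hmem
  simpa using hmem

lemma HasGoodTriangle.exists_altitude {β : ℝ} (hβ : 0 < β) (hβ' : β ≤ Real.pi / 3) {R : Set Plane}
    {a b : Plane} (H : HasGoodTriangle β R a b) :
    ∃ n : Plane, inner ℝ (b - a) n = 0 ∧ ‖n‖ = ‖b - a‖ * Real.tan β / 2 ∧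
      convexHull ℝ {a, b, a + (n + (1 / 2 : ℝ) • (b - a))} ⊆ R := by
  have hab := H.ne hβ'
  obtain ⟨c, hT, h1, h2⟩ := H
  have hT0 := tan_pos_of_le_pi_div_three hβ hβ'
  have hcos : 0 < Real.cos β :=
    Real.cos_pos_of_mem_Ioo ⟨by linarith [Real.pi_pos], by linarith [Real.pi_pos]⟩
  have hsin : 0 < Real.sin β := Real.sin_pos_of_pos_of_lt_pi hβ (by linarith [Real.pi_pos])
  have hdist : dist c a = dist c b := by
    apply EuclideanGeometry.dist_eq_of_angle_eq_angle_of_angle_ne_pi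
    · rw [EuclideanGeometry.angle_comm c a b, EuclideanGeometry.angle_comm c b a, h1, h2]
    · intro h
      have h3 := EuclideanGeometry.angle_eq_zero_of_angle_eq_pi_left h
      rw [EuclideanGeometry.angle_comm] at h3
      linarith
  obtain ⟨e, he⟩ : ∃ e, e = b - a := ⟨_, rfl⟩
  obtain ⟨g, hg⟩ : ∃ g, g = c - a := ⟨_, rfl⟩
  have hb : b = a + e := by rw [he]; abel
  have hc : c = a + g := by rw [hg]; abel
  have he0 : 0 < ‖e‖ := by rw [he]; exact norm_pos_iff.2 (sub_ne_zero.2 hab.symm)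
  have hng : ‖g‖ = ‖g - e‖ := by
    rw [dist_eq_norm, dist_eq_norm] at hdist
    rw [hg, he]; simpa using hdist
  have hin : inner ℝ e g = ‖e‖ ^ 2 / 2 := by
    have h3 := norm_sub_sq_real g e
    rw [← hng, real_inner_comm] at h3
    linarith
  have hcosg : Real.cos β * (‖e‖ * ‖g‖) = inner ℝ e g := by
    rw [← h1, he, hg]
    exact InnerProductGeometry.cos_angle_mul_norm_mul_norm _ _
  have heg : ‖e‖ = 2 * Real.cos β * ‖g‖ := by
    rw [hin] at hcosg
    have : ‖e‖ * (Real.cos β * ‖g‖ * 2) = ‖e‖ * ‖e‖ := by nlinarith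
    linarith [mul_left_cancel₀ he0.ne' this]
  obtain ⟨n, hn⟩ : ∃ n, n = g - (1 / 2 : ℝ) • e := ⟨_, rfl⟩
  have hne : inner ℝ e n = 0 := by
    rw [hn, inner_sub_right, inner_smul_right, real_inner_self_eq_norm_sq, hin]; ring
  have hnn : ‖n‖ = ‖e‖ * Real.tan β / 2 := by
    have h4 : ‖n‖ ^ 2 = (‖e‖ * Real.tan β / 2) ^ 2 := by
      rw [hn, norm_sub_sq_real, inner_smul_right, real_inner_comm, hin, norm_smul,
        Real.tan_eq_sin_div_cos, heg]
      field_simp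
      rw [Real.norm_of_nonneg (by norm_num)]
      have := Real.sin_sq_add_cos_sq β
      have : Real.sin β ^ 2 = 1 - Real.cos β ^ 2 := by linarith
      rw [this]; ring
    exact (pow_left_inj₀ (norm_nonneg _) (by positivity) two_ne_zero).1 h4
  refine ⟨n, he ▸ hne, he ▸ hnn, ?_⟩
  have hc' : a + (n + (1 / 2 : ℝ) • (b - a)) = c := by rw [hn, hc, he]; module
  rwa [hc']

/-- The unit normal of the base of a good triangle pointing into the triangle: around any point
of the base there is a half-disc contained in `R` whose radius is comparable to the distance to
the endpoints of the base. -/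
lemma HasGoodTriangle.exists_normal {β : ℝ} (hβ : 0 < β) (hβ' : β ≤ Real.pi / 3) {R : Set Plane}
    {a b : Plane} (H : HasGoodTriangle β R a b) :
    ∃ f : Plane, ‖f‖ = 1 ∧ ∀ z ∈ segment ℝ a b, ∀ (ρ : ℝ) (h : Plane), ρ ≤ dist z a →
      ρ ≤ dist z b → 0 ≤ inner ℝ f h → ‖h‖ ≤ aperture β * ρ → z + h ∈ R := by
  have hab := H.ne hβ'
  obtain ⟨n, hne, hnn, hT⟩ := H.exists_altitude hβ hβ'
  have hT0 := tan_pos_of_le_pi_div_three hβ hβ'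
  obtain ⟨e, he⟩ : ∃ e, e = b - a := ⟨_, rfl⟩
  have hb : b = a + e := by rw [he]; abel
  have he0 : 0 < ‖e‖ := by rw [he]; exact norm_pos_iff.2 (sub_ne_zero.2 hab.symm)
  rw [← he] at hne hnn hT
  obtain ⟨c, hc⟩ : ∃ c, c = a + (n + (1 / 2 : ℝ) • e) := ⟨_, rfl⟩
  rw [← hc] at hT
  have hn0 : 0 < ‖n‖ := by rw [hnn]; positivity
  refine ⟨(‖n‖⁻¹ : ℝ) • n, by simp [norm_smul, hn0.ne'], ?_⟩
  intro z hz ρ h hρa hρb hfh hh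
  rw [segment_eq_image'] at hz
  obtain ⟨σ, ⟨hσ0, hσ1⟩, rfl⟩ := hz
  have hda : dist (a + σ • (b - a)) a = σ * ‖e‖ := by
    rw [dist_eq_norm, ← he]; simp [norm_smul, abs_of_nonneg hσ0]
  have hdb : dist (a + σ • (b - a)) b = (1 - σ) * ‖e‖ := by
    rw [dist_eq_norm, ← he, hb]
    have : a + σ • e - (a + e) = (σ - 1) • e := by module
    rw [this, norm_smul, Real.norm_eq_abs, abs_of_nonpos (by linarith)]; ring
  have hdec := eq_add_of_inner_eq_zero (norm_pos_iff.1 he0) (norm_pos_iff.1 hn0) hne h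
  obtain ⟨x, hx⟩ : ∃ x, x = inner ℝ e h / ‖e‖ := ⟨_, rfl⟩
  obtain ⟨y, hy⟩ : ∃ y, y = inner ℝ n h / ‖n‖ := ⟨_, rfl⟩
  have hxa : |x| ≤ ‖h‖ := by
    rw [hx, abs_div, abs_of_pos he0, div_le_iff₀ he0, mul_comm]
    exact abs_real_inner_le_norm e h
  have hya : |y| ≤ ‖h‖ := by
    rw [hy, abs_div, abs_of_pos hn0, div_le_iff₀ hn0, mul_comm]
    exact abs_real_inner_le_norm n h
  have hy0 : 0 ≤ y := by
    rw [inner_smul_left, conj_trivial] at hfh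
    rw [hy, div_eq_inv_mul]; exact hfh
  have hx' : inner ℝ e h / ‖e‖ ^ 2 = x / ‖e‖ := by rw [hx]; field_simp
  have hy' : inner ℝ n h / ‖n‖ ^ 2 = y / ‖n‖ := by rw [hy]; field_simp
  rw [hx', hy'] at hdec
  rw [hda] at hρa
  rw [hdb] at hρb
  have key : ‖h‖ * (1 + Real.tan β) ≤ Real.tan β * ρ := by
    unfold aperture at hh
    rw [div_mul_eq_mul_div, le_div_iff₀ (by linarith)] at hh
    exact hh
  obtain ⟨w, hw⟩ : ∃ w, w = y / ‖n‖ := ⟨_, rfl⟩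
  have hw0 : 0 ≤ w := by rw [hw]; positivity
  have hwn : w / 2 * (‖e‖ * Real.tan β) = y := by
    rw [hw, hnn]; field_simp
  have habs := abs_le.1 hxa
  have hyh := (abs_le.1 hya).2
  have e1 : w / 2 ≤ σ + x / ‖e‖ := by
    have : w / 2 * (‖e‖ * Real.tan β) ≤ (σ + x / ‖e‖) * (‖e‖ * Real.tan β) := by
      rw [hwn]
      have : (σ + x / ‖e‖) * (‖e‖ * Real.tan β) = Real.tan β * (σ * ‖e‖ + x) := by field_simp
      rw [this]; nlinarith
    exact le_of_mul_le_mul_right this (by positivity)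
  have e2 : w / 2 ≤ 1 - σ - x / ‖e‖ := by
    have : w / 2 * (‖e‖ * Real.tan β) ≤ (1 - σ - x / ‖e‖) * (‖e‖ * Real.tan β) := by
      rw [hwn]
      have : (1 - σ - x / ‖e‖) * (‖e‖ * Real.tan β) = Real.tan β * ((1 - σ) * ‖e‖ - x) := by
        field_simp
      rw [this]; nlinarith
    exact le_of_mul_le_mul_right this (by positivity)
  apply hT
  have hA : ∀ x ∈ ({a, b, c} : Set Plane), x ∈ convexHull ℝ {a, b, c} :=
    fun x hx => subset_convexHull ℝ _ hx
  have hmem := convex_combo_three (convex_convexHull ℝ {a, b, c}) (hA a (by simp)) (hA b (by simp))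
    (hA c (by simp)) (r := 1 - σ - x / ‖e‖ - w / 2) (s := σ + x / ‖e‖ - w / 2) (t := w)
    (by linarith) (by linarith) hw0 (by ring)
  convert hmem using 1
  rw [hdec, ← hw, ← he, hb, hc]
  module

lemma IsRegularConvexPolygon.interior_nonempty {N₀ : ℕ} {c₀ : ℝ} {Q : Set Plane}
    (H : IsRegularConvexPolygon N₀ c₀ Q) : (interior Q).Nonempty := by
  obtain ⟨-, -, -, -, x₁, x₂, r₁, r₂, hr, hb, -⟩ := H
  exact ⟨x₂, interior_mono hb (ball_subset_interior_closedBall (mem_ball_self hr))⟩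

lemma IsRegularConvexPolygon.closure_interior {N₀ : ℕ} {c₀ : ℝ} {Q : Set Plane}
    (H : IsRegularConvexPolygon N₀ c₀ Q) : closure (interior Q) = Q := by
  rw [H.2.1.closure_interior_eq_closure_of_nonempty_interior H.interior_nonempty,
    H.1.isClosed.closure_eq]

lemma IsRing.isCompact {N₀ : ℕ} {c₀ β : ℝ} {R : Set Plane} (H : IsRing N₀ c₀ β R) :
    IsCompact R := by
  obtain ⟨⟨Q₁, Q₂, h1, -, rfl⟩, -⟩ := H
  exact h1.1.diff isOpen_interior

lemma frontier_diff_interior_eq {N₀ : ℕ} {c₀ : ℝ} {Q₁ Q₂ : Set Plane}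
    (h1 : IsRegularConvexPolygon N₀ c₀ Q₁)
    (h2 : Q₂ = ∅ ∨ (Q₂ ⊆ Q₁ ∧ IsRegularConvexPolygon N₀ c₀ Q₂)) :
    frontier (Q₁ \ interior Q₂) = frontier Q₁ ∪ frontier Q₂ := by
  rcases h2 with rfl | ⟨h12, h2⟩
  · simp
  · have hcl : IsClosed (Q₁ \ interior Q₂) := (h1.1.diff isOpen_interior).isClosed
    apply Subset.antisymm
    · rw [sdiff_eq]
      refine (frontier_inter_subset _ _).trans (union_subset_union inter_subset_left ?_)
      rw [frontier_compl]
      exact inter_subset_right.trans frontier_interior_subset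
    · rintro z (hz | hz)
      · rw [h1.1.isClosed.frontier_eq] at hz
        rw [hcl.frontier_eq]
        exact ⟨⟨hz.1, fun h => hz.2 (interior_mono h12 h)⟩,
          fun h => hz.2 (interior_mono sdiff_subset h)⟩
      · rw [h2.1.isClosed.frontier_eq] at hz
        rw [hcl.frontier_eq]
        refine ⟨⟨h12 hz.1, hz.2⟩, fun h => ?_⟩
        have hz' : z ∈ closure (interior Q₂) := by rw [h2.closure_interior]; exact hz.1
        obtain ⟨y, hy1, hy2⟩ := mem_closure_iff.1 hz' _ isOpen_interior h
        exact (interior_subset hy1).2 hy2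

lemma IsRegularConvexPolygon.exists_finset {N₀ : ℕ} {c₀ : ℝ} {Q : Set Plane}
    (H : IsRegularConvexPolygon N₀ c₀ Q) :
    ∃ T : Finset (Plane × Plane), T.card ≤ N₀ ∧ frontier Q = ⋃ t ∈ T, segment ℝ t.1 t.2 := by
  obtain ⟨-, -, -, ⟨m, v, w, hm, hf⟩, -⟩ := H
  refine ⟨Finset.univ.image fun i => (v i, w i), ?_, ?_⟩
  · exact Finset.card_image_le.trans (by simpa using hm)
  · rw [hf]; simp

lemma IsRing.exists_finset {N₀ : ℕ} {c₀ β : ℝ} {R : Set Plane} (H : IsRing N₀ c₀ β R) :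
    ∃ T : Finset (Plane × Plane), T.card ≤ 2 * N₀ ∧
      frontier R = ⋃ t ∈ T, segment ℝ t.1 t.2 := by
  obtain ⟨⟨Q₁, Q₂, h1, h2, rfl⟩, -⟩ := H
  rw [frontier_diff_interior_eq h1 h2]
  obtain ⟨T₁, hT₁, e₁⟩ := h1.exists_finset
  obtain ⟨T₂, hT₂, e₂⟩ : ∃ T : Finset (Plane × Plane), T.card ≤ N₀ ∧
      frontier Q₂ = ⋃ t ∈ T, segment ℝ t.1 t.2 := by
    rcases h2 with rfl | ⟨-, h2⟩
    · exact ⟨∅, by simp, by simp⟩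
    · exact h2.exists_finset
  refine ⟨T₁ ∪ T₂, (Finset.card_union_le _ _).trans (by omega), ?_⟩
  rw [e₁, e₂, Finset.set_biUnion_union]

lemma exists_segment_eq_image {p q a b : Plane} (hpq : p ≠ q) (hp : p ∈ segment ℝ a b)
    (hq : q ∈ segment ℝ a b) :
    ∃ x y : ℝ, segment ℝ a b = AffineMap.lineMap p q '' Icc x y ∧ x ≤ 0 ∧ 0 ≤ y := by
  rw [segment_eq_image'] at hp hq
  obtain ⟨σ, hσ, hp⟩ := hp
  obtain ⟨ν, hν, hq⟩ := hq
  have hne : ν - σ ≠ 0 := by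
    intro h
    apply hpq
    rw [← hp, ← hq, sub_eq_zero.1 h]
  simp only at hp hq
  have ha : AffineMap.lineMap p q (-σ / (ν - σ)) = a := by
    have hqp : q - p = (ν - σ) • (b - a) := by rw [← hp, ← hq]; module
    rw [AffineMap.lineMap_apply_module', hqp, smul_smul, div_mul_cancel₀ _ hne, ← hp]
    module
  have hb : AffineMap.lineMap p q ((1 - σ) / (ν - σ)) = b := by
    have hqp : q - p = (ν - σ) • (b - a) := by rw [← hp, ← hq]; module
    rw [AffineMap.lineMap_apply_module', hqp, smul_smul, div_mul_cancel₀ _ hne, ← hp]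
    module
  refine ⟨min (-σ / (ν - σ)) ((1 - σ) / (ν - σ)), max (-σ / (ν - σ)) ((1 - σ) / (ν - σ)), ?_, ?_⟩
  · conv_lhs => rw [← ha, ← hb]
    rw [← image_segment, segment_eq_uIcc]; rfl
  · rcases lt_or_gt_of_ne hne with h | h
    · exact ⟨min_le_of_right_le (div_nonpos_of_nonneg_of_nonpos (by linarith [hσ.2]) h.le),
        le_max_of_le_left (div_nonneg_of_nonpos (by linarith [hσ.1]) h.le)⟩
    · exact ⟨min_le_of_left_le (div_nonpos_of_nonpos_of_nonneg (by linarith [hσ.1]) h.le),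
        le_max_of_le_right (div_nonneg (by linarith [hσ.2]) h.le)⟩

lemma exists_segment_union_eq {p q a b c d : Plane} (hpq : p ≠ q) (hp : p ∈ segment ℝ a b)
    (hq : q ∈ segment ℝ a b) (hp' : p ∈ segment ℝ c d) (hq' : q ∈ segment ℝ c d) :
    ∃ x y : Plane, segment ℝ a b ∪ segment ℝ c d = segment ℝ x y := by
  obtain ⟨x, y, e, hx, hy⟩ := exists_segment_eq_image hpq hp hq
  obtain ⟨x', y', e', hx', hy'⟩ := exists_segment_eq_image hpq hp' hq'
  refine ⟨AffineMap.lineMap p q (min x x'), AffineMap.lineMap p q (max y y'), ?_⟩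
  rw [e, e', ← image_union, Icc_union_Icc' (by linarith) (by linarith), ← image_segment,
    segment_eq_Icc ((min_le_left _ _).trans (hx.trans (hy.trans (le_max_left _ _))))]

lemma segment_subset_union_of_mem {a b p : Plane} (hp : p ∈ segment ℝ a b) :
    segment ℝ a b ⊆ segment ℝ a p ∪ segment ℝ p b := by
  intro z hz
  rw [segment_eq_image'] at hp hz
  obtain ⟨σ, hσ, rfl⟩ := hp
  obtain ⟨ν, hν, rfl⟩ := hz
  simp only [segment_eq_image']
  rcases le_total ν σ with h | h
  · left
    rcases hσ.1.eq_or_lt with h0 | h0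
    · exact ⟨0, by simp, by simp [← h0, le_antisymm (h0 ▸ h) hν.1]⟩
    · refine ⟨ν / σ, ⟨div_nonneg hν.1 hσ.1, (div_le_one h0).2 h⟩, ?_⟩
      simp only [add_sub_cancel_left, smul_smul, div_mul_cancel₀ _ h0.ne']
  · right
    rcases hσ.2.eq_or_lt with h0 | h0
    · exact ⟨0, by simp, by simp [h0, le_antisymm hν.2 (h0 ▸ h)]⟩
    · have h1 : (1 - σ) ≠ 0 := by linarith
      refine ⟨(ν - σ) / (1 - σ), ⟨div_nonneg (by linarith) (by linarith),
        (div_le_one (by linarith)).2 (by linarith [hν.2])⟩, ?_⟩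
      have : b - (a + σ • (b - a)) = (1 - σ) • (b - a) := by module
      simp only [this, smul_smul, div_mul_cancel₀ _ h1]
      module

lemma exists_two_mem_of_segment_subset {a b : Plane} (hab : a ≠ b) {T : Finset (Plane × Plane)}
    (h : segment ℝ a b ⊆ ⋃ t ∈ T, segment ℝ t.1 t.2) :
    ∃ t ∈ T, ∃ p q, p ≠ q ∧ p ∈ segment ℝ a b ∧ q ∈ segment ℝ a b ∧
      p ∈ segment ℝ t.1 t.2 ∧ q ∈ segment ℝ t.1 t.2 := by
  by_contra! hcon
  have hinf : (segment ℝ a b).Infinite := by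
    rw [segment_eq_image_lineMap]
    exact (Icc_infinite one_pos).image (AffineMap.lineMap_injective ℝ hab).injOn
  apply hinf
  have hfin : (⋃ t ∈ T, segment ℝ a b ∩ segment ℝ t.1 t.2).Finite := by
    refine T.finite_toSet.biUnion fun t ht => Subsingleton.finite ?_
    intro p hp q hq
    by_contra hpq
    exact hcon t ht p q hpq hp.1 hq.1 hp.2 hq.2
  refine hfin.subset fun z hz => ?_
  obtain ⟨t, ht, hzt⟩ := mem_iUnion₂.1 (h hz)
  exact mem_iUnion₂.2 ⟨t, ht, hz, hzt⟩

/-- The boundary of a ring is covered by a controlled number of segments carrying good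
triangles. -/
lemma IsRing.exists_half_edges {N₀ : ℕ} {c₀ β : ℝ} (hβ' : β ≤ Real.pi / 3) {R : Set Plane}
    (H : IsRing N₀ c₀ β R) :
    ∃ E : Finset (Plane × Plane), E.card ≤ 4 * N₀ ∧
      frontier R ⊆ ⋃ e ∈ E, segment ℝ e.1 e.2 ∧ ∀ e ∈ E, HasGoodTriangle β R e.1 e.2 := by
  obtain ⟨T, hT, hfT⟩ := H.exists_finset
  obtain ⟨-, m, v, w, hf, hmax, hgood⟩ := H
  choose p hp hg1 hg2 using hgood
  have hvw : ∀ i, v i ≠ w i := by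
    intro i h
    have hpi := hp i
    rw [← h, segment_same, mem_singleton_iff] at hpi
    exact (hg1 i).ne hβ' hpi.symm
  have hsub : ∀ i, segment ℝ (v i) (w i) ⊆ frontier R := fun i => by
    rw [hf]; exact subset_iUnion (fun i => segment ℝ (v i) (w i)) i
  have hchoice : ∀ i, ∃ t ∈ T, ∃ p q, p ≠ q ∧ p ∈ segment ℝ t.1 t.2 ∧ q ∈ segment ℝ t.1 t.2 ∧
      segment ℝ t.1 t.2 ⊆ segment ℝ (v i) (w i) := by
    intro i
    obtain ⟨t, ht, p, q, hpq, h1, h2, h3, h4⟩ :=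
      exists_two_mem_of_segment_subset (hvw i) ((hsub i).trans hfT.subset)
    refine ⟨t, ht, p, q, hpq, h3, h4, ?_⟩
    obtain ⟨x, y, hxy⟩ := exists_segment_union_eq hpq h1 h2 h3 h4
    rw [← hmax i x y (hxy ▸ subset_union_left) ?_, ← hxy]
    · exact subset_union_right
    · rw [← hxy]
      refine union_subset (hsub i) ?_
      rw [hfT]
      exact subset_biUnion_of_mem (u := fun t : Plane × Plane => segment ℝ t.1 t.2) ht
  choose F hFT P Q hPQ hP hQ hFsub using hchoice
  have hinj : ∀ i j, F i = F j → segment ℝ (v i) (w i) = segment ℝ (v j) (w j) := by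
    intro i j hij
    have hsubj := hFsub j
    rw [← hij] at hsubj
    obtain ⟨x, y, hxy⟩ := exists_segment_union_eq (hPQ i) (hFsub i (hP i)) (hFsub i (hQ i))
      (hsubj (hP i)) (hsubj (hQ i))
    have hxy' : segment ℝ x y ⊆ frontier R := hxy ▸ union_subset (hsub i) (hsub j)
    rw [← hmax i x y (hxy ▸ subset_union_left) hxy', hmax j x y (hxy ▸ subset_union_right) hxy']
  let I : Finset (Plane × Plane) := Finset.univ.image F
  have hI : I.card ≤ 2 * N₀ := by
    refine (Finset.card_le_card fun t ht => ?_).trans hT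
    obtain ⟨i, -, rfl⟩ := Finset.mem_image.1 ht
    exact hFT i
  have hr : ∀ t : I, ∃ i, F i = t := fun t => by
    obtain ⟨i, -, h⟩ := Finset.mem_image.1 t.2
    exact ⟨i, h⟩
  choose G hG using hr
  refine ⟨Finset.univ.biUnion fun t : I => {(v (G t), p (G t)), (p (G t), w (G t))}, ?_, ?_, ?_⟩
  · refine (Finset.card_biUnion_le_card_mul _ _ 2 fun t _ => Finset.card_le_two).trans ?_
    simp only [Finset.card_univ, Fintype.card_coe]
    omega
  · intro z hz
    rw [hf] at hz
    obtain ⟨i, hi⟩ := mem_iUnion.1 hz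
    have ht : F i ∈ I := Finset.mem_image_of_mem _ (Finset.mem_univ _)
    rw [← hinj _ _ (hG ⟨F i, ht⟩)] at hi
    rcases segment_subset_union_of_mem (hp _) hi with h | h
    · exact mem_iUnion₂.2 ⟨_, Finset.mem_biUnion.2 ⟨⟨F i, ht⟩, Finset.mem_univ _,
        Finset.mem_insert_self _ _⟩, h⟩
    · exact mem_iUnion₂.2 ⟨_, Finset.mem_biUnion.2 ⟨⟨F i, ht⟩, Finset.mem_univ _,
        Finset.mem_insert_of_mem (Finset.mem_singleton_self _)⟩, h⟩
  · intro e he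
    obtain ⟨t, -, ht⟩ := Finset.mem_biUnion.1 he
    rcases Finset.mem_insert.1 ht with rfl | ht
    · exact hg1 _
    · rw [Finset.mem_singleton.1 ht]
      exact hg2 _

lemma exists_mem_frontier_of_isPreconnected {α : Type*} [TopologicalSpace α] {s R : Set α}
    (hs : IsPreconnected s) (h1 : (s ∩ R).Nonempty) (h2 : (s ∩ Rᶜ).Nonempty) :
    (s ∩ frontier R).Nonempty := by
  by_contra hcon
  have hcov : s ⊆ interior R ∪ (closure R)ᶜ := by
    intro z hz
    by_contra hz'
    simp only [mem_union, mem_compl_iff, not_or, not_not] at hz'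
    exact hcon ⟨z, hz, hz'.2, hz'.1⟩
  obtain ⟨a, has, haR⟩ := h1
  obtain ⟨b, hbs, hbR⟩ := h2
  have ha : a ∈ interior R := (hcov has).resolve_right fun h => h (subset_closure haR)
  have hb : b ∈ (closure R)ᶜ := (hcov hbs).resolve_left fun h => hbR (interior_subset h)
  obtain ⟨z, -, hz1, hz2⟩ := hs _ _ isOpen_interior isClosed_closure.isOpen_compl hcov
    ⟨a, has, ha⟩ ⟨b, hbs, hb⟩
  exact hz2 (subset_closure (interior_subset hz1))

lemma exists_mem_frontier_add_smul {R : Set Plane} {y h : Plane} {l : ℝ} (hl : 0 ≤ l)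
    (hy : y ∈ R) (hy' : y + l • h ∉ R) : ∃ t ∈ Icc 0 l, y + t • h ∈ frontier R := by
  have hpre : IsPreconnected ((fun t : ℝ => y + t • h) '' Icc 0 l) :=
    isPreconnected_Icc.image _ (by fun_prop)
  obtain ⟨z, ⟨t, ht, rfl⟩, hz⟩ := exists_mem_frontier_of_isPreconnected (R := R) hpre
    ⟨y, ⟨0, ⟨le_rfl, hl⟩, by simp⟩, hy⟩ ⟨_, ⟨l, ⟨hl, le_rfl⟩, rfl⟩, hy'⟩
  exact ⟨t, ht, hz⟩

/-- A point of a ring whose line in direction `h` leaves the ring on both sides after a short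
distance is close to an endpoint of a boundary segment. -/
lemma exists_endpoint_near {β : ℝ} (hβ : 0 < β) (hβ' : β ≤ Real.pi / 3) {R : Set Plane}
    {E : Finset (Plane × Plane)} (hcov : frontier R ⊆ ⋃ e ∈ E, segment ℝ e.1 e.2)
    (hgood : ∀ e ∈ E, HasGoodTriangle β R e.1 e.2) {y h : Plane} {M l m : ℝ} (hy : y ∈ R)
    (hl : 0 ≤ l) (hlM : l ≤ M) (hyl : y - l • h ∉ R) (hm : 0 ≤ m) (hmM : m ≤ M)
    (hym : y + m • h ∉ R) :
    ∃ e ∈ E, dist y e.1 ≤ (1 + 2 / aperture β) * (M * ‖h‖) ∨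
      dist y e.2 ≤ (1 + 2 / aperture β) * (M * ‖h‖) := by
  have hκ := aperture_pos hβ hβ'
  obtain ⟨t, ⟨ht0, htl⟩, hz⟩ := exists_mem_frontier_add_smul (h := -h) hl hy
    (by rwa [smul_neg, ← sub_eq_add_neg])
  obtain ⟨e, he, hze⟩ := mem_iUnion₂.1 (hcov hz)
  refine ⟨e, he, ?_⟩
  by_contra! hcon
  obtain ⟨f, -, hf⟩ := (hgood e he).exists_normal hβ hβ'
  obtain ⟨z, hzy⟩ : ∃ z, z = y + t • -h := ⟨_, rfl⟩
  rw [← hzy] at hze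
  have hyz : dist y z ≤ M * ‖h‖ := by
    rw [hzy, dist_eq_norm, sub_add_cancel_left, smul_neg, neg_neg, norm_smul,
      Real.norm_of_nonneg ht0]
    exact mul_le_mul_of_nonneg_right (htl.trans hlM) (norm_nonneg _)
  have hρ : ∀ x, (1 + 2 / aperture β) * (M * ‖h‖) < dist y x →
      2 / aperture β * (M * ‖h‖) ≤ dist z x := by
    intro x hx
    have := dist_triangle y z x
    linarith
  have hκρ : aperture β * (2 / aperture β * (M * ‖h‖)) = 2 * M * ‖h‖ := by
    field_simp
  have hnorm : ∀ c : ℝ, |c| ≤ 2 * M → ‖c • h‖ ≤ aperture β * (2 / aperture β * (M * ‖h‖)) := by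
    intro c hc
    rw [hκρ, norm_smul, Real.norm_eq_abs]
    exact mul_le_mul_of_nonneg_right hc (norm_nonneg _)
  rcases le_total (inner ℝ f h) 0 with hfh | hfh
  · apply hyl
    have := hf z hze _ ((t - l) • h) (hρ _ hcon.1) (hρ _ hcon.2)
      (by rw [inner_smul_right]; exact mul_nonneg_of_nonpos_of_nonpos (by linarith) hfh)
      (hnorm _ (by rw [abs_of_nonpos (by linarith)]; linarith))
    rw [hzy] at this
    convert this using 1; module
  · apply hym
    have := hf z hze _ ((t + m) • h) (hρ _ hcon.1) (hρ _ hcon.2)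
      (by rw [inner_smul_right]; exact mul_nonneg (by linarith) hfh)
      (hnorm _ (by rw [abs_of_nonneg (by linarith)]; linarith))
    rw [hzy] at this
    convert this using 1; module

lemma exists_unit_inner_eq_zero {u : Plane} (hu : u ≠ 0) :
    ∃ e : Plane, ‖e‖ = 1 ∧ inner ℝ e u = 0 := by
  have h0 : inner ℝ (!₂[-u 1, u 0] : Plane) u = 0 := by
    simp [PiLp.inner_apply, Fin.sum_univ_two]; ring
  have hne : (!₂[-u 1, u 0] : Plane) ≠ 0 := by
    intro h
    apply hu
    have h1 := congrArg (fun v : Plane => v 0) h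
    have h2 := congrArg (fun v : Plane => v 1) h
    simp at h1 h2
    ext i
    fin_cases i <;> simp [h1, h2]
  refine ⟨(‖(!₂[-u 1, u 0] : Plane)‖⁻¹ : ℝ) • !₂[-u 1, u 0], ?_, ?_⟩
  · rw [norm_smul, norm_inv, norm_norm, inv_mul_cancel₀ (norm_ne_zero_iff.2 hne)]
  · rw [inner_smul_left, h0, mul_zero]

lemma dist_midpoint_ge {a b p q : Plane} (hp : p ∈ segment ℝ a b) (hq : q ∈ segment ℝ a b) :
    dist p q / 2 ≤ dist (midpoint ℝ p q) a ∧ dist p q / 2 ≤ dist (midpoint ℝ p q) b := by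
  rw [segment_eq_image'] at hp hq
  obtain ⟨σ, hσ, rfl⟩ := hp
  obtain ⟨ν, hν, rfl⟩ := hq
  have h1 : a + σ • (b - a) - (a + ν • (b - a)) = (σ - ν) • (b - a) := by module
  have h2 : midpoint ℝ (a + σ • (b - a)) (a + ν • (b - a)) - a = ((σ + ν) / 2) • (b - a) := by
    rw [midpoint_eq_smul_add]; simp only [invOf_eq_inv]; module
  have h3 : midpoint ℝ (a + σ • (b - a)) (a + ν • (b - a)) - b =
      ((σ + ν) / 2 - 1) • (b - a) := by
    rw [midpoint_eq_smul_add]; simp only [invOf_eq_inv]; module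
  simp only [dist_eq_norm, h1, h2, h3, norm_smul, Real.norm_eq_abs]
  have hn := norm_nonneg (b - a)
  rw [abs_of_nonneg (show 0 ≤ (σ + ν) / 2 by linarith [hσ.1, hν.1]),
    abs_of_nonpos (show (σ + ν) / 2 - 1 ≤ 0 by linarith [hσ.2, hν.2])]
  have h4 : |σ - ν| ≤ σ + ν := abs_le.2 ⟨by linarith [hσ.1, hν.1], by linarith [hσ.1, hν.1]⟩
  have h5 : |σ - ν| ≤ 2 - σ - ν :=
    abs_le.2 ⟨by linarith [hσ.2, hν.2], by linarith [hσ.2, hν.2]⟩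
  constructor <;> nlinarith

/-- Two distant points on the base of a good triangle yield a large ball in the ring. -/
lemma HasGoodTriangle.exists_closedBall {β : ℝ} (hβ : 0 < β) (hβ' : β ≤ Real.pi / 3)
    {R : Set Plane} {a b p q : Plane} (H : HasGoodTriangle β R a b) (hp : p ∈ segment ℝ a b)
    (hq : q ∈ segment ℝ a b) {ε : ℝ} (hε : 0 ≤ ε) (hpq : ε ≤ dist p q) :
    ∃ c, dist c (midpoint ℝ p q) ≤ ε ∧ closedBall c (aperture β * ε / 4) ⊆ R := by
  have hκ := aperture_pos hβ hβ'
  have hκ1 := aperture_lt_one hβ hβ'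
  obtain ⟨f, hf1, hf⟩ := H.exists_normal hβ hβ'
  obtain ⟨r, hr⟩ : ∃ r, r = aperture β * ε / 4 := ⟨_, rfl⟩
  have hr0 : 0 ≤ r := by rw [hr]; positivity
  obtain ⟨h1, h2⟩ := dist_midpoint_ge hp hq
  rw [← hr]
  refine ⟨midpoint ℝ p q + r • f, ?_, fun x hx => ?_⟩
  · rw [dist_eq_norm, add_sub_cancel_left, norm_smul, hf1, Real.norm_of_nonneg hr0, hr]
    nlinarith
  · rw [mem_closedBall, dist_eq_norm] at hx
    obtain ⟨v, hv⟩ : ∃ v, v = x - (midpoint ℝ p q + r • f) := ⟨_, rfl⟩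
    rw [← hv] at hx
    have hx' : x = midpoint ℝ p q + (r • f + v) := by rw [hv]; module
    rw [hx']
    refine hf _ ((convex_segment a b).midpoint_mem hp hq) (ε / 2) _ (by linarith) (by linarith)
      ?_ ?_
    · rw [inner_add_right, inner_smul_right, real_inner_self_eq_norm_sq, hf1]
      have h3 := abs_real_inner_le_norm f v
      rw [hf1, one_mul] at h3
      linarith [(abs_le.1 h3).1]
    · refine (norm_add_le _ _).trans ?_
      rw [norm_smul, hf1, Real.norm_of_nonneg hr0]
      linarith

/-- Near any boundary point of a regular convex set there is a transversal family of boundary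
points. -/
lemma exists_frontier_family {Q : Set Plane} (hQ : IsClosed Q) (hconv : Convex ℝ Q)
    {w w₁ z : Plane} {σ c₀ : ℝ} (hσ : 0 < σ) (hw : closedBall w σ ⊆ Q)
    (hw₁ : Q ⊆ closedBall w₁ (c₀ * σ)) (hz : z ∈ frontier Q) :
    ∃ P : ℝ → Plane, ∀ s ∈ Ioc 0 σ, P s ∈ frontier Q ∧ dist (P s) z ≤ (1 + 4 * c₀) * s ∧
      ∀ s' ∈ Ioc 0 σ, |s - s'| ≤ dist (P s) (P s') := by
  rw [hQ.frontier_eq] at hz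
  have hwint : ball w σ ⊆ interior Q := by
    rw [isOpen_ball.subset_interior_iff]; exact ball_subset_closedBall.trans hw
  obtain ⟨u, hu⟩ : ∃ u, u = w - z := ⟨_, rfl⟩
  have hw' : w = z + u := by rw [hu]; module
  have hu0 : u ≠ 0 := by
    rintro rfl
    apply hz.2
    have : z = w := by rw [hw', add_zero]
    rw [this]; exact hwint (mem_ball_self hσ)
  have hun : ‖u‖ ≤ 2 * c₀ * σ := by
    have h1 := mem_closedBall.1 (hw₁ hz.1)
    have h2 := mem_closedBall.1 (hw₁ (hw (mem_closedBall_self hσ.le)))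
    rw [hu, ← dist_eq_norm]
    linarith [dist_triangle_right w z w₁]
  obtain ⟨e, he1, heu⟩ := exists_unit_inner_eq_zero hu0
  have key : ∀ s ∈ Ioc 0 σ, ∃ l : ℝ, |l| ≤ 2 * s / σ ∧ z + s • e + l • u ∈ frontier Q := by
    rintro s ⟨hs0, hs1⟩
    have hA : z + s • e + (s / σ) • u ∈ Q := by
      have hwe : w + σ • e ∈ Q := hw (by
        rw [mem_closedBall, dist_eq_norm, add_sub_cancel_left, norm_smul, he1,
          Real.norm_of_nonneg hσ.le, mul_one])
      have := hconv hz.1 hwe (a := 1 - s / σ) (b := s / σ)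
        (by rw [sub_nonneg, div_le_one hσ]; exact hs1) (by positivity) (by ring)
      convert this using 1
      rw [hw']
      have : (s / σ) • (z + u + σ • e) = (s / σ) • (z + u) + s • e := by
        rw [smul_add, smul_smul, div_mul_cancel₀ _ hσ.ne']
      rw [this]; module
    have hB : z + s • e + (-(2 * s / σ)) • u ∉ Q := by
      intro hB
      apply hz.2
      have hwe : w + (-(σ / 2)) • e ∈ interior Q := hwint (by
        rw [mem_ball, dist_eq_norm, add_sub_cancel_left, norm_smul, he1, norm_neg,
          Real.norm_of_nonneg (by positivity), mul_one]
        linarith)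
      have h1 : 0 < σ + 2 * s := by linarith
      have := hconv.combo_interior_self_mem_interior hwe hB (a := 2 * s / (σ + 2 * s))
        (b := σ / (σ + 2 * s)) (by positivity) (by positivity) (by field_simp; ring)
      convert this using 1
      rw [hw']
      have e1 : (2 * s / (σ + 2 * s)) = 1 - σ / (σ + 2 * s) := by field_simp; ring
      have e2 : (2 * s / (σ + 2 * s)) * -(σ / 2) + σ / (σ + 2 * s) * s = 0 := by field_simp; ring
      have e3 : (2 * s / (σ + 2 * s)) + σ / (σ + 2 * s) * -(2 * s / σ) = 0 := by field_simp; ring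
      have : (2 * s / (σ + 2 * s)) • (z + u + -(σ / 2) • e) +
          (σ / (σ + 2 * s)) • (z + s • e + -(2 * s / σ) • u) =
          ((2 * s / (σ + 2 * s)) + σ / (σ + 2 * s)) • z +
          ((2 * s / (σ + 2 * s)) * -(σ / 2) + σ / (σ + 2 * s) * s) • e +
          ((2 * s / (σ + 2 * s)) + σ / (σ + 2 * s) * -(2 * s / σ)) • u := by module
      rw [this, e2, e3, e1]; module
    obtain ⟨t, ⟨ht0, ht1⟩, ht⟩ := exists_mem_frontier_add_smul (y := z + s • e + (s / σ) • u)
      (h := -u) (l := 3 * s / σ) (by positivity) hA (by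
        convert hB using 2
        rw [smul_neg, ← neg_smul, add_assoc, ← add_smul]
        congr 2; ring)
    refine ⟨s / σ - t, ?_, ?_⟩
    · have : 0 < s / σ := by positivity
      rw [mul_div_assoc] at ht1 ⊢
      exact abs_le.2 ⟨by linarith, by linarith⟩
    · convert ht using 1; module
  choose! l hl hlf using key
  refine ⟨fun s => z + s • e + l s • u, fun s hs => ⟨hlf s hs, ?_, fun s' _ => ?_⟩⟩
  · have h1 : z + s • e + l s • u - z = s • e + l s • u := by module
    rw [dist_eq_norm, h1]
    refine (norm_add_le _ _).trans ?_
    rw [norm_smul, norm_smul, he1, Real.norm_of_nonneg hs.1.le, Real.norm_eq_abs]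
    have := mul_le_mul (hl s hs) hun (norm_nonneg _) (by have := hs.1; positivity)
    have h2 : 2 * s / σ * (2 * c₀ * σ) = 4 * c₀ * s := by field_simp; ring
    linarith
  · have h1 : inner ℝ e (z + s • e + l s • u - (z + s' • e + l s' • u)) = s - s' := by
      have : z + s • e + l s • u - (z + s' • e + l s' • u) = (s - s') • e + (l s - l s') • u := by
        module
      rw [this, inner_add_right, inner_smul_right, inner_smul_right, heu,
        real_inner_self_eq_norm_sq, he1]
      ring
    have h2 := abs_real_inner_le_norm e (z + s • e + l s • u - (z + s' • e + l s' • u))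
    rw [h1, he1, one_mul, ← dist_eq_norm] at h2
    exact h2

/-- A set of small diameter misses one of two sub-balls of a ball. -/
lemma exists_closedBall_disjoint {Q : Set Plane} {y w : Plane} {a b : ℝ} (ha : 0 < a)
    (hb : b ≤ a / 8) (hQ : Q ⊆ closedBall w b) :
    ∃ c, closedBall c (a / 4) ⊆ closedBall y a \ Q := by
  by_contra! hcon
  have hsub : ∀ v : Plane, ‖v‖ = 1 → closedBall (y + (a / 2) • v) (a / 4) ⊆ closedBall y a := by
    intro v hv
    apply closedBall_subset_closedBall'
    rw [dist_eq_norm, add_sub_cancel_left, norm_smul, hv, Real.norm_of_nonneg (by positivity)]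
    linarith
  have hmeet : ∀ v : Plane, ‖v‖ = 1 → ∃ x ∈ Q, x ∈ closedBall (y + (a / 2) • v) (a / 4) := by
    intro v hv
    have := hcon (y + (a / 2) • v)
    rw [not_subset] at this
    obtain ⟨x, hx, hx'⟩ := this
    refine ⟨x, ?_, hx⟩
    by_contra hxQ
    exact hx' ⟨hsub v hv hx, hxQ⟩
  have h1 : ‖(EuclideanSpace.single 0 1 : Plane)‖ = 1 := by simp
  obtain ⟨x, hxQ, hx⟩ := hmeet _ h1
  obtain ⟨x', hxQ', hx'⟩ := hmeet (-EuclideanSpace.single 0 1) (by rw [norm_neg, h1])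
  have hd1 := mem_closedBall.1 (hQ hxQ)
  have hd2 := mem_closedBall.1 (hQ hxQ')
  rw [mem_closedBall, dist_comm] at hx
  rw [mem_closedBall] at hx'
  have hc : dist (y + (a / 2) • (EuclideanSpace.single 0 1 : Plane))
      (y + (a / 2) • -(EuclideanSpace.single 0 1 : Plane)) = a := by
    have : y + (a / 2) • (EuclideanSpace.single 0 1 : Plane) -
      (y + (a / 2) • -(EuclideanSpace.single 0 1 : Plane)) =
        a • (EuclideanSpace.single 0 1 : Plane) := by module
    rw [dist_eq_norm, this, norm_smul, h1, Real.norm_of_nonneg ha.le, mul_one]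
  have := dist_triangle4 (y + (a / 2) • (EuclideanSpace.single 0 1 : Plane)) x x'
    (y + (a / 2) • -(EuclideanSpace.single 0 1 : Plane))
  have := dist_triangle_right x x' w
  linarith

lemma IsRing.exists_closedBall_of_hole {N₀ : ℕ} {c₀ β : ℝ} (hβ : 0 < β) (hβ' : β ≤ Real.pi / 3)
    (hc₀ : 1 ≤ c₀) {R Q : Set Plane} (H : IsRing N₀ c₀ β R) (hQ : IsClosed Q)
    (hconv : Convex ℝ Q) {w w₁ z : Plane} {σ δ : ℝ} (hδ : 0 < δ) (hδσ : δ ≤ σ)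
    (hw : closedBall w σ ⊆ Q) (hw₁ : Q ⊆ closedBall w₁ (c₀ * σ)) (hz : z ∈ frontier Q)
    (hQR : frontier Q ⊆ frontier R) :
    ∃ c, dist c z ≤ (3 + 4 * c₀) * δ ∧
      closedBall c (aperture β * (δ / (4 * N₀ + 1)) / 4) ⊆ R := by
  obtain ⟨E, hEc, hcov, hgood⟩ := H.exists_half_edges hβ'
  obtain ⟨P, hP⟩ := exists_frontier_family hQ hconv (hδ.trans_le hδσ) hw hw₁ hz
  obtain ⟨ε, hε⟩ : ∃ ε, ε = δ / (4 * N₀ + 1) := ⟨_, rfl⟩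
  have hN : (0 : ℝ) < 4 * N₀ + 1 := by positivity
  have hε0 : 0 < ε := by rw [hε]; positivity
  have hεδ : (4 * N₀ + 1) * ε = δ := by rw [hε]; field_simp
  have hεδ' : ε ≤ δ := by rw [← hεδ]; nlinarith [(Nat.cast_nonneg N₀ : (0 : ℝ) ≤ N₀)]
  have hk : ∀ k : Fin (4 * N₀ + 1), ((k : ℝ) + 1) * ε ∈ Ioc 0 δ := by
    intro k
    refine ⟨by positivity, ?_⟩
    rw [← hεδ]
    have : (k : ℝ) ≤ 4 * N₀ := by exact_mod_cast Nat.lt_succ_iff.1 k.2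
    nlinarith
  have hkσ : ∀ k : Fin (4 * N₀ + 1), ((k : ℝ) + 1) * ε ∈ Ioc 0 σ :=
    fun k => ⟨(hk k).1, (hk k).2.trans hδσ⟩
  have hch : ∀ k : Fin (4 * N₀ + 1), ∃ e ∈ E, P (((k : ℝ) + 1) * ε) ∈ segment ℝ e.1 e.2 :=
    fun k => by simpa using hcov (hQR (hP _ (hkσ k)).1)
  choose F hF hFs using hch
  obtain ⟨k, -, k', -, hkk, hFk⟩ := Finset.exists_ne_map_eq_of_card_lt_of_maps_to
    (s := (Finset.univ : Finset (Fin (4 * N₀ + 1)))) (t := E) (f := F)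
    (by rw [Finset.card_univ, Fintype.card_fin]; omega) (fun k _ => hF k)
  have hdist : ε ≤ dist (P (((k : ℝ) + 1) * ε)) (P (((k' : ℝ) + 1) * ε)) := by
    refine le_trans ?_ ((hP _ (hkσ k)).2.2 _ (hkσ k'))
    have : ((k : ℝ) + 1) * ε - ((k' : ℝ) + 1) * ε = (((k : ℤ) - (k' : ℤ) : ℤ) : ℝ) * ε := by
      push_cast; ring
    rw [this, abs_mul, abs_of_pos hε0, ← Int.cast_abs]
    have h1 : (1 : ℤ) ≤ |(k : ℤ) - (k' : ℤ)| := Int.one_le_abs (by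
      intro h; apply hkk; ext; omega)
    have h2 : (1 : ℝ) ≤ ((|(k : ℤ) - (k' : ℤ)| : ℤ) : ℝ) := by exact_mod_cast h1
    nlinarith
  have hFs' := hFs k'
  rw [← hFk] at hFs'
  obtain ⟨c, hc, hcR⟩ := (hgood _ (hF k)).exists_closedBall hβ hβ' (hFs k) hFs' hε0.le hdist
  rw [← hε]
  refine ⟨c, ?_, hcR⟩
  have hm : dist (midpoint ℝ (P (((k : ℝ) + 1) * ε)) (P (((k' : ℝ) + 1) * ε))) z ≤
      (1 + 4 * c₀) * δ := by
    refine (convex_closedBall z ((1 + 4 * c₀) * δ)).midpoint_mem ?_ ?_ <;>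
      rw [mem_closedBall]
    · exact (hP _ (hkσ k)).2.1.trans (mul_le_mul_of_nonneg_left (hk k).2 (by linarith))
    · exact (hP _ (hkσ k')).2.1.trans (mul_le_mul_of_nonneg_left (hk k').2 (by linarith))
  have := dist_triangle c (midpoint ℝ (P (((k : ℝ) + 1) * ε)) (P (((k' : ℝ) + 1) * ε))) z
  linarith

/-- The relative size of the balls contained in a ring. -/
def ringThickness (N₀ : ℕ) (c₀ β : ℝ) : ℝ := aperture β / (32 * c₀ ^ 2 * (4 * N₀ + 1))

lemma ringThickness_pos {N₀ : ℕ} {c₀ β : ℝ} (hβ : 0 < β) (hβ' : β ≤ Real.pi / 3)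
    (hc₀ : 1 ≤ c₀) : 0 < ringThickness N₀ c₀ β := by
  have := aperture_pos hβ hβ'
  unfold ringThickness
  positivity

lemma ringThickness_le {N₀ : ℕ} {c₀ β : ℝ} (hβ : 0 < β) (hβ' : β ≤ Real.pi / 3)
    (hc₀ : 1 ≤ c₀) : ringThickness N₀ c₀ β ≤ 1 / c₀ / 4 := by
  have := aperture_lt_one hβ hβ'
  have := aperture_pos hβ hβ'
  have hN := (Nat.cast_nonneg N₀ : (0 : ℝ) ≤ N₀)
  unfold ringThickness
  rw [div_div, div_le_div_iff₀ (by positivity) (by positivity)]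
  have h1 : c₀ ≤ c₀ ^ 2 := by nlinarith
  have h2 : c₀ ^ 2 ≤ c₀ ^ 2 * (4 * N₀ + 1) := by nlinarith [sq_nonneg c₀]
  have h3 : aperture β * (c₀ * 4) ≤ 1 * (c₀ * 4) := by gcongr
  nlinarith

/-- Measure density of rings at all scales up to their size. -/
lemma IsRing.exists_density {N₀ : ℕ} {c₀ β : ℝ} (hβ : 0 < β) (hβ' : β ≤ Real.pi / 3)
    (hc₀ : 1 ≤ c₀) {R : Set Plane} (H : IsRing N₀ c₀ β R) :
    ∃ d > 0, ∃ x, R ⊆ closedBall x d ∧ ∀ y ∈ R, ∀ r, 0 < r → r ≤ d →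
      ∃ c, closedBall c (ringThickness N₀ c₀ β * r) ⊆ R ∩ closedBall y ((7 + 4 * c₀) * r) := by
  have hκ := aperture_pos hβ hβ'
  have hκ1 := aperture_lt_one hβ hβ'
  have hthp := ringThickness_pos (N₀ := N₀) hβ hβ' hc₀
  have hth := ringThickness_le (N₀ := N₀) hβ hβ' hc₀
  have H' := H
  obtain ⟨⟨Q₁, Q₂, h1, h2, rfl⟩, -⟩ := H'
  have hfr := frontier_diff_interior_eq h1 h2
  have h1' := h1
  obtain ⟨-, hconv, -, -, x₁, x₂, r₁, ρ, hρ, hb, hb', hr⟩ := h1'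
  have hb'' : Q₁ ⊆ closedBall x₁ (c₀ * ρ) := hb'.trans (closedBall_subset_closedBall hr)
  refine ⟨c₀ * ρ, by positivity, x₁, sdiff_subset.trans hb'', fun y hy r hr0 hrd => ?_⟩
  obtain ⟨θ, hθ⟩ : ∃ θ, θ = r / (c₀ * ρ) := ⟨_, rfl⟩
  have hθ0 : 0 < θ := by rw [hθ]; positivity
  have hθ1 : θ ≤ 1 := by rw [hθ, div_le_one (by positivity)]; exact hrd
  have hθr : θ * (c₀ * ρ) = r := by rw [hθ]; field_simp
  obtain ⟨a, ha⟩ : ∃ a, a = θ * ρ := ⟨_, rfl⟩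
  have ha0 : 0 < a := by rw [ha]; positivity
  have har : c₀ * a = r := by rw [ha, ← hθr]; ring
  have har' : a ≤ r := by rw [← har]; nlinarith
  have hra : 1 / c₀ * r = a := by rw [← har]; field_simp
  obtain ⟨y', hy'⟩ : ∃ y', y' = y + θ • (x₂ - y) := ⟨_, rfl⟩
  have hx₂ : x₂ ∈ Q₁ := hb (mem_closedBall_self hρ.le)
  have hyx : dist x₂ y ≤ 2 * (c₀ * ρ) := by
    have e1 := mem_closedBall.1 (hb'' hx₂)
    have e2 := mem_closedBall.1 (hb'' hy.1)
    linarith [dist_triangle_right x₂ y x₁]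
  have hyy : dist y' y ≤ 2 * r := by
    rw [hy', dist_eq_norm, add_sub_cancel_left, norm_smul, Real.norm_of_nonneg hθ0.le,
      ← dist_eq_norm]
    nlinarith
  have hBQ : closedBall y' a ⊆ Q₁ := by
    intro x hx
    have hx' : x₂ + θ⁻¹ • (x - y') ∈ Q₁ := by
      apply hb
      rw [mem_closedBall, dist_eq_norm, add_sub_cancel_left, norm_smul, norm_inv,
        Real.norm_of_nonneg hθ0.le, ← dist_eq_norm, inv_mul_le_iff₀ hθ0, ← ha]
      exact hx
    have := hconv hy.1 hx' (a := 1 - θ) (b := θ) (by linarith) hθ0.le (by ring)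
    convert this using 1
    rw [smul_add, smul_smul, mul_inv_cancel₀ hθ0.ne', hy']
    module
  have hBy : closedBall y' a ⊆ closedBall y (3 * r) := by
    apply closedBall_subset_closedBall'
    linarith
  have hsmall : ∀ c, closedBall c (a / 4) ⊆ closedBall y' a \ interior Q₂ →
      ∃ c, closedBall c (ringThickness N₀ c₀ β * r) ⊆
        Q₁ \ interior Q₂ ∩ closedBall y ((7 + 4 * c₀) * r) := by
    intro c hc
    refine ⟨c, fun x hx => ?_⟩
    have hx' : x ∈ closedBall c (a / 4) := by
      refine closedBall_subset_closedBall ?_ hx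
      rw [← hra]
      have := mul_le_mul_of_nonneg_right hth hr0.le
      linarith
    have hx2 := hc hx'
    exact ⟨⟨hBQ hx2.1, hx2.2⟩, closedBall_subset_closedBall (by nlinarith) (hBy hx2.1)⟩
  by_cases hcase : Disjoint (closedBall y' a) (interior Q₂)
  · exact hsmall y' (subset_sdiff.2 ⟨closedBall_subset_closedBall (by linarith),
      hcase.mono_left (closedBall_subset_closedBall (by linarith))⟩)
  obtain ⟨q, hq1, hq2⟩ := not_disjoint_iff.1 hcase
  rcases h2 with rfl | ⟨h21, h2⟩
  · simp at hq2
  have h2' := h2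
  obtain ⟨hcomp, hconv₂, -, -, w₁, w, s₁, σ, hσ, hbw, hbw', hs⟩ := h2'
  have hbw'' : Q₂ ⊆ closedBall w₁ (c₀ * σ) := hbw'.trans (closedBall_subset_closedBall hs)
  rcases le_or_gt (c₀ * σ) (a / 8) with hcs | hcs
  · obtain ⟨c, hc⟩ := exists_closedBall_disjoint (y := y') ha0 hcs
      (interior_subset.trans hbw'')
    exact hsmall c hc
  obtain ⟨z, hzs, hz⟩ := exists_mem_frontier_of_isPreconnected (R := interior Q₂)
    (convex_segment (𝕜 := ℝ) y q).isPreconnected ⟨q, right_mem_segment ℝ y q, hq2⟩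
    ⟨y, left_mem_segment ℝ y q, hy.2⟩
  have hzy : dist z y ≤ 3 * r :=
    (convex_closedBall y (3 * r)).segment_subset (mem_closedBall_self (by linarith)) (hBy hq1) hzs
  obtain ⟨δ, hδ⟩ : ∃ δ, δ = a / (8 * c₀) := ⟨_, rfl⟩
  have hδ0 : 0 < δ := by rw [hδ]; positivity
  have hδr : 8 * c₀ ^ 2 * δ = r := by rw [hδ, ← har]; field_simp
  have hδr' : δ ≤ r := by rw [← hδr]; nlinarith
  have hδσ : δ ≤ σ := by
    rw [hδ, div_le_iff₀ (by positivity)]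
    linarith
  obtain ⟨c, hc, hcR⟩ := H.exists_closedBall_of_hole hβ hβ' hc₀ hcomp.isClosed hconv₂ hδ0 hδσ hbw
    hbw'' (frontier_interior_subset hz) (by rw [hfr]; exact subset_union_right)
  have hrad : aperture β * (δ / (4 * N₀ + 1)) / 4 = ringThickness N₀ c₀ β * r := by
    rw [← hδr, ringThickness]; field_simp; ring
  rw [hrad] at hcR
  refine ⟨c, subset_inter hcR (closedBall_subset_closedBall' ?_)⟩
  have hκr : ringThickness N₀ c₀ β * r ≤ r := by
    have : 1 / c₀ ≤ 1 := (div_le_one (by linarith)).2 hc₀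
    nlinarith
  have hcr : (3 + 4 * c₀) * δ ≤ (3 + 4 * c₀) * r := by gcongr
  linarith [dist_triangle c z y]

lemma card_mul_sq_le_of_closedBall_subset {ι : Type*} (J : Finset ι) (U : ι → Set Plane) {x : Plane}
    {a b : ℝ} (ha : 0 < a) (hb : 0 ≤ b)
    (hdisj : ∀ i ∈ J, ∀ j ∈ J, i ≠ j → interior (U i) ∩ interior (U j) = ∅)
    (hU : ∀ j ∈ J, ∃ c, closedBall c a ⊆ U j ∩ closedBall x b) :
    (J.card : ℝ) * a ^ 2 ≤ b ^ 2 := by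
  choose! c hc using hU
  have hint : ∀ j ∈ J, ball (c j) a ⊆ interior (U j) := fun j hj =>
    isOpen_ball.subset_interior_iff.2
      (ball_subset_closedBall.trans ((hc j hj).trans inter_subset_left))
  have hpd : (J : Set ι).PairwiseDisjoint fun j => ball (c j) a := by
    intro i hi j hj hij
    refine Set.disjoint_iff_inter_eq_empty.2 (subset_empty_iff.1 ?_)
    rw [← hdisj i hi j hj hij]
    exact inter_subset_inter (hint i hi) (hint j hj)
  have hvol := measure_biUnion_finset (μ := volume) hpd fun j _ => measurableSet_ball
  have hle : volume (⋃ j ∈ J, ball (c j) a) ≤ volume (closedBall x b) :=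
    measure_mono (iUnion₂_subset fun j hj =>
      ball_subset_closedBall.trans ((hc j hj).trans inter_subset_right))
  rw [hvol] at hle
  simp only [EuclideanSpace.volume_ball_fin_two, EuclideanSpace.volume_closedBall_fin_two,
    Finset.sum_const, nsmul_eq_mul] at hle
  rw [← mul_assoc] at hle
  replace hle := (ENNReal.mul_le_mul_iff_left (by simp [Real.pi_pos]) ENNReal.ofReal_ne_top).1 hle
  rw [
    ← ENNReal.ofReal_pow ha.le, ← ENNReal.ofReal_pow hb, ← ENNReal.ofReal_natCast,
    ← ENNReal.ofReal_mul (by positivity)] at hle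
  exact (ENNReal.ofReal_le_ofReal_iff (by positivity)).1 hle

/-- The bound for the number of larger rings meeting a given ring. -/
def ringOverlap (N₀ : ℕ) (c₀ β : ℝ) : ℝ := ((8 + 4 * c₀) / ringThickness N₀ c₀ β) ^ 2

lemma card_le_ringOverlap {N₀ : ℕ} {c₀ β : ℝ} (hβ : 0 < β) (hβ' : β ≤ Real.pi / 3)
    (hc₀ : 1 ≤ c₀) {ι : Type*} (J : Finset ι) (U : ι → Set Plane) (d' : ι → ℝ)
    (hdisj : ∀ i j, i ≠ j → interior (U i) ∩ interior (U j) = ∅)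
    (hU : ∀ j, ∀ y ∈ U j, ∀ r, 0 < r → r ≤ d' j → ∃ c,
      closedBall c (ringThickness N₀ c₀ β * r) ⊆ U j ∩ closedBall y ((7 + 4 * c₀) * r))
    {R : Set Plane} {x : Plane} {d : ℝ} (hd : 0 < d) (hR : R ⊆ closedBall x d)
    (hJ : ∀ j ∈ J, (R ∩ U j).Nonempty ∧ d ≤ d' j) :
    (J.card : ℝ) ≤ ringOverlap N₀ c₀ β := by
  have hth := ringThickness_pos (N₀ := N₀) hβ hβ' hc₀
  have := card_mul_sq_le_of_closedBall_subset J U (x := x) (a := ringThickness N₀ c₀ β * d)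
    (b := (8 + 4 * c₀) * d) (by positivity) (by positivity) (fun i _ j _ h => hdisj i j h) (by
      intro j hj
      obtain ⟨⟨y, hyR, hyU⟩, hdj⟩ := hJ j hj
      obtain ⟨c, hc⟩ := hU j y hyU d hd hdj
      refine ⟨c, hc.trans (inter_subset_inter_right _ (closedBall_subset_closedBall' ?_))⟩
      have := mem_closedBall.1 (hR hyR)
      linarith)
  rw [ringOverlap, div_pow, le_div_iff₀ (by positivity)]
  rw [mul_pow, mul_pow, ← mul_assoc] at this
  exact le_of_mul_le_mul_right this (by positivity)

lemma card_filter_prod_le {ι κ : Type*} [Fintype ι] [Fintype κ] (p : ι → κ → Prop)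
    [∀ i j, Decidable (p i j)] {C : ℝ}
    (h : ∀ i, ((Finset.univ.filter fun j => p i j).card : ℝ) ≤ C) :
    ((Finset.univ.filter fun q : ι × κ => p q.1 q.2).card : ℝ) ≤ Fintype.card ι * C := by
  rw [Finset.card_filter, Fintype.sum_prod_type]
  push_cast
  calc _ ≤ ∑ _i : ι, C := Finset.sum_le_sum fun i _ => by
        have := h i
        rw [Finset.card_filter] at this
        push_cast at this
        exact this
    _ = _ := by simp

/-- The number of intersecting pairs of rings of two decompositions is linear in `n`. -/
lemma card_inter_pairs_le {N₀ : ℕ} {c₀ β : ℝ} (hβ : 0 < β) (hβ' : β ≤ Real.pi / 3)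
    (hc₀ : 1 ≤ c₀) {n : ℕ} (U V : Fin n → Set Plane) (hU : ∀ i, IsRing N₀ c₀ β (U i))
    (hV : ∀ i, IsRing N₀ c₀ β (V i))
    (hdU : ∀ i j, i ≠ j → interior (U i) ∩ interior (U j) = ∅)
    (hdV : ∀ i j, i ≠ j → interior (V i) ∩ interior (V j) = ∅) :
    ((Finset.univ.filter fun q : Fin n × Fin n => (U q.1 ∩ V q.2).Nonempty).card : ℝ) ≤
      2 * ringOverlap N₀ c₀ β * n := by
  choose d hd x hx hD using fun i => (hU i).exists_density hβ hβ' hc₀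
  choose d' hd' x' hx' hD' using fun i => (hV i).exists_density hβ hβ' hc₀
  have h1 := card_filter_prod_le (fun i j : Fin n => (U i ∩ V j).Nonempty ∧ d i ≤ d' j)
    (fun i => card_le_ringOverlap hβ hβ' hc₀ _ V d' hdV hD' (hd i) (hx i)
      (fun j hj => (Finset.mem_filter.1 hj).2))
  have h2 := card_filter_prod_le (fun j i : Fin n => (V j ∩ U i).Nonempty ∧ d' j ≤ d i)
    (fun j => card_le_ringOverlap hβ hβ' hc₀ _ U d hdU hD (hd' j) (hx' j)
      (fun i hi => (Finset.mem_filter.1 hi).2))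
  have h3 : (Finset.univ.filter fun q : Fin n × Fin n => (U q.1 ∩ V q.2).Nonempty).card ≤
      (Finset.univ.filter fun q : Fin n × Fin n => (U q.1 ∩ V q.2).Nonempty ∧ d q.1 ≤ d' q.2).card +
      (Finset.univ.filter fun q : Fin n × Fin n =>
        (V q.1 ∩ U q.2).Nonempty ∧ d' q.1 ≤ d q.2).card := by
    rw [← Finset.card_map (Equiv.prodComm (Fin n) (Fin n)).toEmbedding
      (s := Finset.univ.filter fun q : Fin n × Fin n =>
        (V q.1 ∩ U q.2).Nonempty ∧ d' q.1 ≤ d q.2)]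
    refine (Finset.card_le_card fun q hq => ?_).trans (Finset.card_union_le _ _)
    have hq' := (Finset.mem_filter.1 hq).2
    rw [Finset.mem_union]
    rcases le_total (d q.1) (d' q.2) with h | h
    · exact Or.inl (Finset.mem_filter.2 ⟨Finset.mem_univ _, hq', h⟩)
    · exact Or.inr (Finset.mem_map.2 ⟨(q.2, q.1), Finset.mem_filter.2
        ⟨Finset.mem_univ _, by rw [inter_comm]; exact hq', h⟩, rfl⟩)
  rw [Fintype.card_fin] at h1 h2
  have h4 : ((Finset.univ.filter fun q : Fin n × Fin n => (U q.1 ∩ V q.2).Nonempty).card : ℝ) ≤ _ :=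
    Nat.cast_le.2 h3
  push_cast at h4
  linarith

lemma IsRing.volume_frontier {N₀ : ℕ} {c₀ β : ℝ} {R : Set Plane} (H : IsRing N₀ c₀ β R) :
    volume (frontier R) = 0 := by
  obtain ⟨⟨Q₁, Q₂, h1, h2, rfl⟩, -⟩ := H
  rw [frontier_diff_interior_eq h1 h2, measure_union_null_iff]
  refine ⟨h1.2.1.addHaar_frontier _, ?_⟩
  rcases h2 with rfl | ⟨-, h2⟩
  · simp
  · exact h2.2.1.addHaar_frontier _

lemma IsRing.volume_inter {N₀ : ℕ} {c₀ β : ℝ} {R R' : Set Plane} (H : IsRing N₀ c₀ β R)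
    (H' : IsRing N₀ c₀ β R') (hd : interior R ∩ interior R' = ∅) : volume (R ∩ R') = 0 := by
  refine measure_mono_null (fun z hz => ?_)
    (measure_union_null H.volume_frontier H'.volume_frontier)
  rw [H.isCompact.isClosed.frontier_eq, H'.isCompact.isClosed.frontier_eq]
  by_contra hcon
  simp only [mem_union, mem_sdiff, hz.1, hz.2, true_and, not_or, not_not] at hcon
  exact (hd ▸ (show z ∈ interior R ∩ interior R' from hcon) : z ∈ (∅ : Set Plane))

lemma exists_run_left {L : Set ℤ} (hL : L.Finite) (y : ℤ) :
    ∃ a ≤ y, (∀ j, a ≤ j → j < y → j ∈ L) ∧ a - 1 ∉ L := by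
  have hex : ∃ t : ℕ, y - 1 - t ∉ L := by
    by_contra! h
    exact Set.infinite_of_injective_forall_mem (f := fun t : ℕ => y - 1 - t)
      (fun s t h => by simpa using h) h hL
  refine ⟨y - Nat.find hex, by omega, fun j h1 h2 => ?_, ?_⟩
  · have h3 := Nat.find_min hex (m := (y - 1 - j).toNat) (by omega)
    rw [not_not] at h3
    convert h3 using 1
    omega
  · have := Nat.find_spec hex
    convert this using 2
    omega

lemma exists_run_right {L : Set ℤ} (hL : L.Finite) (y : ℤ) :
    ∃ b ≥ y, (∀ j, y ≤ j → j < b → j ∈ L) ∧ b ∉ L := by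
  have hex : ∃ t : ℕ, y + t ∉ L := by
    by_contra! h
    exact Set.infinite_of_injective_forall_mem (f := fun t : ℕ => y + t)
      (fun s t h => by simpa using h) h hL
  refine ⟨y + Nat.find hex, by omega, fun j h1 h2 => ?_, Nat.find_spec hex⟩
  have h3 := Nat.find_min hex (m := (j - y).toNat) (by omega)
  rw [not_not] at h3
  convert h3 using 1
  omega

lemma eq_of_forall_succ_eq {v : ℤ → ℝ} {a b : ℤ} (hab : a ≤ b)
    (h : ∀ j, a ≤ j → j < b → v (j + 1) = v j) : v b = v a := by
  induction b, hab using Int.leInduction with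
  | base => rfl
  | succ n hn ih =>
    rw [h n hn (by omega)]
    exact ih fun j h1 h2 => h j h1 (by omega)

lemma one_le_sum_Icc {φ : ℤ → ℝ≥0∞} {w m l : ℤ} (hwm : w ≤ m) (hl : 0 < l)
    (hlm : l ≤ 2 * (m - w + 1)) (hφ : ∀ y ∈ Finset.Icc w m, ENNReal.ofReal (2 / (l : ℝ)) ≤ φ y) :
    1 ≤ ∑ y ∈ Finset.Icc w m, φ y := by
  refine le_trans ?_ (Finset.card_nsmul_le_sum _ _ _ hφ)
  rw [nsmul_eq_mul, Int.card_Icc, ← ENNReal.ofReal_natCast, ← ENNReal.ofReal_mul (by positivity),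
    ← ENNReal.ofReal_one]
  apply ENNReal.ofReal_le_ofReal
  have h1 : (((m + 1 - w).toNat : ℕ) : ℝ) = ((m - w + 1 : ℤ) : ℝ) := by
    rw [← Int.cast_natCast, Int.toNat_of_nonneg (by omega)]
    congr 1; ring
  rw [h1, mul_div_assoc', le_div_iff₀ (by exact_mod_cast hl), one_mul]
  have : (l : ℝ) ≤ ((2 * (m - w + 1) : ℤ) : ℝ) := by exact_mod_cast hlm
  push_cast at this ⊢
  linarith

/-- The link `k'` which compensates a jump at the link `k`. -/
def IsCompensated (L : Set ℤ) (k k' : ℤ) : Prop :=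
  k' = k ∨ (k' < k ∧ ∀ j, 2 * k' - k ≤ j → j < k → j ∈ L) ∨
    (k < k' ∧ ∀ j, k < j → j ≤ 2 * k' - k → j ∈ L)

lemma IsCompensated.injective {L : Set ℤ} {k₁ k₂ m : ℤ} (h₁ : k₁ ∉ L) (h₂ : k₂ ∉ L)
    (H₁ : IsCompensated L k₁ m) (H₂ : IsCompensated L k₂ m) : k₁ = k₂ := by
  by_contra hne
  rcases H₁ with rfl | ⟨h, H₁⟩ | ⟨h, H₁⟩ <;> rcases H₂ with rfl | ⟨h', H₂⟩ | ⟨h', H₂⟩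
  · exact hne rfl
  · exact h₁ (H₂ _ (by omega) (by omega))
  · exact h₁ (H₂ _ (by omega) (by omega))
  · exact h₂ (H₁ _ (by omega) (by omega))
  · rcases lt_or_gt_of_ne hne with h3 | h3
    · exact h₁ (H₂ _ (by omega) (by omega))
    · exact h₂ (H₁ _ (by omega) (by omega))
  · by_cases h3 : 2 * m - k₁ ≤ k₂
    · exact h₂ (H₁ _ (by omega) (by omega))
    · exact h₁ (H₂ _ (by omega) (by omega))
  · exact h₂ (H₁ _ (by omega) (by omega))
  · by_cases h3 : 2 * m - k₂ ≤ k₁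
    · exact h₁ (H₂ _ (by omega) (by omega))
    · exact h₂ (H₁ _ (by omega) (by omega))
  · rcases lt_or_gt_of_ne hne with h3 | h3
    · exact h₂ (H₁ _ (by omega) (by omega))
    · exact h₁ (H₂ _ (by omega) (by omega))

/-- Windows to the left and to the right of a link `k` on which both sequences are constant and
which carry mass at least one. -/
lemma exists_windows {A B : Finset ℤ} {L₁ L₂ : Set ℤ} (hL₁ : L₁ ⊆ A) (hL₂ : L₂ ⊆ A)
    (hB : ∀ k ∈ A, k ∈ B ∧ k + 1 ∈ B) {v : ℤ → ℝ} (hv : ∀ k ∈ L₂, v (k + 1) = v k)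
    {φ : ℤ → ℝ≥0∞}
    (hφ₁ : ∀ y ∈ B, ∀ a b, a ≤ y → y ≤ b → a - 1 ∉ L₁ → b ∉ L₁ →
      ENNReal.ofReal (2 / ((b - a + 1 : ℤ) : ℝ)) ≤ φ y)
    (hφ₂ : ∀ y ∈ B, ∀ a b, a ≤ y → y ≤ b → a - 1 ∉ L₂ → b ∉ L₂ →
      ENNReal.ofReal (2 / ((b - a + 1 : ℤ) : ℝ)) ≤ φ y)
    {k : ℤ} (hkA : k ∈ A) (hk : k ∉ L₁) :
    ∃ (W W' : Finset ℤ) (x x' k' : ℤ) (flag : Prop),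
      (∀ y ∈ W, y ∈ B ∧ y ≤ k ∧ (∀ j, y ≤ j → j < k → j ∈ L₁) ∧ v y = v x) ∧
      (∀ y ∈ W', y ∈ B ∧ k < y ∧ (∀ j, k < j → j < y → j ∈ L₁) ∧ v y = v x') ∧
      1 ≤ ∑ y ∈ W, φ y ∧ 1 ≤ ∑ y ∈ W', φ y ∧
      (flag → IsCompensated L₁ k k' ∧ k' ∈ A ∧ v x' - v x = v (k' + 1) - v k') ∧
      (¬ flag → v x' = v x) := by
  have f₁ : L₁.Finite := A.finite_toSet.subset hL₁
  have f₂ : L₂.Finite := A.finite_toSet.subset hL₂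
  obtain ⟨i₀, hi₀, hi₀L, hi₀n⟩ := exists_run_left f₁ k
  obtain ⟨i₁, hi₁, hi₁L, hi₁n⟩ := exists_run_right f₁ (k + 1)
  -- the left and right windows, cut at the ends of runs of the second partition
  have left : ∀ m j₀ j₁ : ℤ, i₀ ≤ m → m ≤ k → j₀ ≤ m → m ≤ j₁ →
      (∀ j, j₀ ≤ j → j < m → j ∈ L₂) → j₀ - 1 ∉ L₂ → j₁ ∉ L₂ →
      (k - i₀ + 1 ≤ 2 * (m - max i₀ j₀ + 1) ∨
        (i₀ ≤ j₀ ∧ j₁ - j₀ + 1 ≤ 2 * (m - max i₀ j₀ + 1))) →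
      (∀ y ∈ Finset.Icc (max i₀ j₀) m, y ∈ B ∧ y ≤ k ∧ (∀ j, y ≤ j → j < k → j ∈ L₁) ∧
        v y = v m) ∧ 1 ≤ ∑ y ∈ Finset.Icc (max i₀ j₀) m, φ y := by
    intro m j₀ j₁ hm₁ hm₂ hj₀ hj₁ hjL hn₀ hn₁ hlen
    have hyB : ∀ y ∈ Finset.Icc (max i₀ j₀) m, y ∈ B := by
      intro y hy
      rw [Finset.mem_Icc, max_le_iff] at hy
      rcases (hy.2.trans hm₂).eq_or_lt with h | h
      · exact (hB y (h ▸ hkA)).1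
      · exact (hB y (hL₁ (hi₀L y hy.1.1 h))).1
    refine ⟨fun y hy => ⟨hyB y hy, ?_⟩, ?_⟩
    · rw [Finset.mem_Icc, max_le_iff] at hy
      refine ⟨hy.2.trans hm₂, fun j h1 h2 => hi₀L j (by omega) h2, ?_⟩
      exact (eq_of_forall_succ_eq hy.2 fun j h1 h2 => hv j (hjL j (by omega) h2)).symm
    · rcases hlen with hlen | ⟨-, hlen⟩
      · refine one_le_sum_Icc (by omega) (by omega) hlen fun y hy => ?_
        have hyb := hyB y hy
        rw [Finset.mem_Icc, max_le_iff] at hy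
        exact hφ₁ y hyb i₀ k hy.1.1 (hy.2.trans hm₂) hi₀n hk
      · refine one_le_sum_Icc (by omega) (by omega) hlen fun y hy => ?_
        have hyb := hyB y hy
        rw [Finset.mem_Icc, max_le_iff] at hy
        exact hφ₂ y hyb j₀ j₁ hy.1.2 (hy.2.trans hj₁) hn₀ hn₁
  have right : ∀ m j₀ j₁ : ℤ, m ≤ i₁ → k + 1 ≤ m → j₀ ≤ m → m ≤ j₁ →
      (∀ j, m ≤ j → j < j₁ → j ∈ L₂) → j₀ - 1 ∉ L₂ → j₁ ∉ L₂ →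
      (i₁ - k ≤ 2 * (min i₁ j₁ - m + 1) ∨
        (j₁ ≤ i₁ ∧ j₁ - j₀ + 1 ≤ 2 * (min i₁ j₁ - m + 1))) →
      (∀ y ∈ Finset.Icc m (min i₁ j₁), y ∈ B ∧ k < y ∧ (∀ j, k < j → j < y → j ∈ L₁) ∧
        v y = v m) ∧ 1 ≤ ∑ y ∈ Finset.Icc m (min i₁ j₁), φ y := by
    intro m j₀ j₁ hm₁ hm₂ hj₀ hj₁ hjL hn₀ hn₁ hlen
    have hyB : ∀ y ∈ Finset.Icc m (min i₁ j₁), y ∈ B := by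
      intro y hy
      rw [Finset.mem_Icc, le_min_iff] at hy
      rcases (hm₂.trans hy.1).eq_or_lt with h | h
      · exact h ▸ (hB k hkA).2
      · have := (hB (y - 1) (hL₁ (hi₁L (y - 1) (by omega) (by omega)))).2
        rwa [sub_add_cancel] at this
    refine ⟨fun y hy => ⟨hyB y hy, ?_⟩, ?_⟩
    · rw [Finset.mem_Icc, le_min_iff] at hy
      refine ⟨by omega, fun j h1 h2 => hi₁L j (by omega) (by omega), ?_⟩
      exact eq_of_forall_succ_eq hy.1 fun j h1 h2 => hv j (hjL j h1 (by omega))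
    · rcases hlen with hlen | ⟨-, hlen⟩
      · refine one_le_sum_Icc (by omega) (by omega) hlen fun y hy => ?_
        have hyb := hyB y hy
        rw [Finset.mem_Icc, le_min_iff] at hy
        have := hφ₁ y hyb (k + 1) i₁ (by omega) hy.2.1 (by simpa using hk) hi₁n
        convert this using 4
        ring
      · refine one_le_sum_Icc (by omega) (by omega) hlen fun y hy => ?_
        have hyb := hyB y hy
        rw [Finset.mem_Icc, le_min_iff] at hy
        exact hφ₂ y hyb j₀ j₁ (by omega) hy.2.2 hn₀ hn₁
  obtain ⟨j₀, hj₀, hj₀L, hj₀n⟩ := exists_run_left f₂ k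
  obtain ⟨j₁, hj₁, hj₁L, hj₁n⟩ := exists_run_right f₂ (k + 1)
  by_cases hk₂ : k ∈ L₂
  swap
  · obtain ⟨l1, l2⟩ := left k j₀ k hi₀ le_rfl hj₀ le_rfl hj₀L hj₀n hk₂ (by omega)
    obtain ⟨r1, r2⟩ := right (k + 1) (k + 1) j₁ hi₁ le_rfl le_rfl hj₁ hj₁L
      (by simpa using hk₂) hj₁n (by omega)
    exact ⟨_, _, k, k + 1, k, True, l1, r1, l2, r2, fun _ => ⟨Or.inl rfl, hkA, rfl⟩,
      fun h => absurd trivial h⟩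
  have hvk := hv k hk₂
  have hv₀ : v k = v j₀ := eq_of_forall_succ_eq hj₀ fun j h1 h2 => hv j (hj₀L j h1 h2)
  have hv₁ : v j₁ = v (k + 1) := eq_of_forall_succ_eq hj₁ fun j h1 h2 => hv j (hj₁L j h1 h2)
  rcases le_or_gt (k - j₀ + 1) (j₁ - k) with hr | hr
  · obtain ⟨r1, r2⟩ := right (k + 1) j₀ j₁ hi₁ le_rfl (by omega) hj₁ hj₁L hj₀n hj₁n (by omega)
    by_cases hi : i₀ ≤ k - 2 * (k - j₀ + 1)
    · obtain ⟨j₂, hj₂, hj₂L, hj₂n⟩ := exists_run_left f₂ (j₀ - 1)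
      obtain ⟨l1, l2⟩ := left (j₀ - 1) j₂ (j₀ - 1) (by omega) (by omega) hj₂ le_rfl hj₂L hj₂n
        hj₀n (by omega)
      refine ⟨_, _, j₀ - 1, k + 1, j₀ - 1, True, l1, r1, l2, r2, fun _ => ⟨?_, ?_, ?_⟩,
        fun h => absurd trivial h⟩
      · exact Or.inr (Or.inl ⟨by omega, fun j h1 h2 => hi₀L j (by omega) h2⟩)
      · exact hL₁ (hi₀L _ (by omega) (by omega))
      · rw [sub_add_cancel, hvk, hv₀]
    · obtain ⟨l1, l2⟩ := left k j₀ j₁ hi₀ le_rfl hj₀ (by omega) hj₀L hj₀n hj₁n (by omega)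
      exact ⟨_, _, k, k + 1, k, False, l1, r1, l2, r2, False.elim, fun _ => hvk⟩
  · obtain ⟨l1, l2⟩ := left k j₀ j₁ hi₀ le_rfl hj₀ (by omega) hj₀L hj₀n hj₁n (by omega)
    by_cases hi : k + 2 * (j₁ - k) < i₁
    · obtain ⟨j₂, hj₂, hj₂L, hj₂n⟩ := exists_run_right f₂ (j₁ + 1)
      obtain ⟨r1, r2⟩ := right (j₁ + 1) (j₁ + 1) j₂ (by omega) (by omega) le_rfl hj₂ hj₂L
        (by simpa using hj₁n) hj₂n (by omega)
      refine ⟨_, _, k, j₁ + 1, j₁, True, l1, r1, l2, r2, fun _ => ⟨?_, ?_, ?_⟩,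
        fun h => absurd trivial h⟩
      · exact Or.inr (Or.inr ⟨by omega, fun j h1 h2 => hi₁L j (by omega) (by omega)⟩)
      · exact hL₁ (hi₁L _ (by omega) (by omega))
      · rw [hv₁, hvk]
    · obtain ⟨r1, r2⟩ := right (k + 1) j₀ j₁ hi₁ le_rfl (by omega) hj₁ hj₁L hj₀n hj₁n (by omega)
      exact ⟨_, _, k, k + 1, k, False, l1, r1, l2, r2, False.elim, fun _ => hvk⟩

lemma sum_rpow_le_of_windows {τ : ℝ} {N B : Finset ℤ} {W : ℤ → Finset ℤ}
    (hWB : ∀ k ∈ N, W k ⊆ B)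
    (hdisj : ∀ k ∈ N, ∀ l ∈ N, k ≠ l → Disjoint (W k) (W l)) {φ D d : ℤ → ℝ≥0∞}
    (hφ : ∀ k ∈ N, 1 ≤ ∑ y ∈ W k, φ y) (hd : ∀ k ∈ N, ∀ y ∈ W k, d k = D y) :
    ∑ k ∈ N, d k ^ τ ≤ ∑ y ∈ B, D y ^ τ * φ y := by
  calc ∑ k ∈ N, d k ^ τ ≤ ∑ k ∈ N, ∑ y ∈ W k, D y ^ τ * φ y := by
        refine Finset.sum_le_sum fun k hk => ?_
        calc d k ^ τ = d k ^ τ * 1 := (mul_one _).symm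
          _ ≤ d k ^ τ * ∑ y ∈ W k, φ y := by gcongr; exact hφ k hk
          _ = _ := by
            rw [Finset.mul_sum]
            exact Finset.sum_congr rfl fun y hy => by rw [hd k hk y hy]
    _ = ∑ y ∈ N.biUnion W, D y ^ τ * φ y :=
        (Finset.sum_biUnion fun k hk l hl h => hdisj k hk l hl h).symm
    _ ≤ _ := Finset.sum_le_sum_of_subset (Finset.biUnion_subset.2 hWB)

/-- Comparison of the variations of two piecewise constant sequences. -/
lemma chain_variation_le {τ : ℝ} (hτ : 1 ≤ τ) {A B : Finset ℤ} {L₁ L₂ : Set ℤ} (hL₁ : L₁ ⊆ A)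
    (hL₂ : L₂ ⊆ A) (hB : ∀ k ∈ A, k ∈ B ∧ k + 1 ∈ B) {u v : ℤ → ℝ}
    (hu : ∀ k ∈ L₁, u (k + 1) = u k) (hv : ∀ k ∈ L₂, v (k + 1) = v k) {φ : ℤ → ℝ≥0∞}
    (hφ₁ : ∀ y ∈ B, ∀ a b, a ≤ y → y ≤ b → a - 1 ∉ L₁ → b ∉ L₁ →
      ENNReal.ofReal (2 / ((b - a + 1 : ℤ) : ℝ)) ≤ φ y)
    (hφ₂ : ∀ y ∈ B, ∀ a b, a ≤ y → y ≤ b → a - 1 ∉ L₂ → b ∉ L₂ →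
      ENNReal.ofReal (2 / ((b - a + 1 : ℤ) : ℝ)) ≤ φ y) :
    (∑ k ∈ A, ‖u (k + 1) - u k‖ₑ ^ τ) ^ (1 / τ) ≤
      (∑ k ∈ A, ‖v (k + 1) - v k‖ₑ ^ τ) ^ (1 / τ) +
        2 * (∑ y ∈ B, ‖u y - v y‖ₑ ^ τ * φ y) ^ (1 / τ) := by
  have hτ0 : 0 < τ := by linarith
  have H := fun (k : ℤ) (hk : k ∈ A ∧ k ∉ L₁) =>
    exists_windows hL₁ hL₂ hB hv hφ₁ hφ₂ hk.1 hk.2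
  choose! W W' x x' k' flag hW hW' hWφ hWφ' hflag hnflag using H
  obtain ⟨N, hN⟩ : ∃ N, N = A.filter fun k => k ∉ L₁ := ⟨_, rfl⟩
  have hNm : ∀ k ∈ N, k ∈ A ∧ k ∉ L₁ := fun k hk => by
    rw [hN] at hk; exact Finset.mem_filter.1 hk
  have hAN : ∑ k ∈ A, ‖u (k + 1) - u k‖ₑ ^ τ = ∑ k ∈ N, ‖u (k + 1) - u k‖ₑ ^ τ := by
    rw [hN]
    refine (Finset.sum_filter_of_ne (p := fun k => k ∉ L₁) fun k _ hne hkL => hne ?_).symm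
    rw [hu k hkL, sub_self, enorm_zero, ENNReal.zero_rpow_of_pos hτ0]
  have hul : ∀ k ∈ N, ∀ y ∈ W k, u k = u y := fun k hk y hy =>
    have h := hW k (hNm k hk) y hy
    eq_of_forall_succ_eq h.2.1 fun j h1 h2 => hu j (h.2.2.1 j h1 h2)
  have hur : ∀ k ∈ N, ∀ y ∈ W' k, u y = u (k + 1) := fun k hk y hy =>
    have h := hW' k (hNm k hk) y hy
    eq_of_forall_succ_eq h.2.1 fun j h1 h2 => hu j (h.2.2.1 j (by omega) h2)
  have hl : ∑ k ∈ N, ‖u k - v (x k)‖ₑ ^ τ ≤ ∑ y ∈ B, ‖u y - v y‖ₑ ^ τ * φ y := by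
    refine sum_rpow_le_of_windows (D := fun y => ‖u y - v y‖ₑ) (d := fun k => ‖u k - v (x k)‖ₑ)
      (W := W) (fun k hk y hy => (hW k (hNm k hk) y hy).1) (fun k hk l hl hkl => ?_)
      (fun k hk => hWφ k (hNm k hk)) fun k hk y hy => ?_
    · rw [Finset.disjoint_left]
      intro y hyk hyl
      have h1 := hW k (hNm k hk) y hyk
      have h2 := hW l (hNm l hl) y hyl
      rcases lt_or_gt_of_ne hkl with h | h
      · exact (hNm k hk).2 (h2.2.2.1 k h1.2.1 h)
      · exact (hNm l hl).2 (h1.2.2.1 l h2.2.1 h)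
    · rw [hul k hk y hy, (hW k (hNm k hk) y hy).2.2.2]
  have hr : ∑ k ∈ N, ‖u (k + 1) - v (x' k)‖ₑ ^ τ ≤ ∑ y ∈ B, ‖u y - v y‖ₑ ^ τ * φ y := by
    refine sum_rpow_le_of_windows (D := fun y => ‖u y - v y‖ₑ)
      (d := fun k => ‖u (k + 1) - v (x' k)‖ₑ)
      (W := W') (fun k hk y hy => (hW' k (hNm k hk) y hy).1) (fun k hk l hl hkl => ?_)
      (fun k hk => hWφ' k (hNm k hk)) fun k hk y hy => ?_
    · rw [Finset.disjoint_left]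
      intro y hyk hyl
      have h1 := hW' k (hNm k hk) y hyk
      have h2 := hW' l (hNm l hl) y hyl
      rcases lt_or_gt_of_ne hkl with h | h
      · exact (hNm l hl).2 (h1.2.2.1 l h h2.2.1)
      · exact (hNm k hk).2 (h2.2.2.1 k h h1.2.1)
    · rw [hur k hk y hy, (hW' k (hNm k hk) y hy).2.2.2]
  obtain ⟨g, hg⟩ : ∃ g : ℤ → ℝ≥0∞, g = fun k =>
    if flag k then ‖v (k' k + 1) - v (k' k)‖ₑ else 0 := ⟨_, rfl⟩
  have hgs : ∑ k ∈ N, g k ^ τ ≤ ∑ k ∈ A, ‖v (k + 1) - v k‖ₑ ^ τ := by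
    have h1 : ∑ k ∈ N, g k ^ τ =
        ∑ k ∈ N.filter flag, ‖v (k' k + 1) - v (k' k)‖ₑ ^ τ := by
      rw [Finset.sum_filter]
      refine Finset.sum_congr rfl fun k _ => ?_
      rw [hg]
      by_cases h : flag k <;> simp [h, ENNReal.zero_rpow_of_pos hτ0]
    have h2 : Set.InjOn k' (N.filter flag : Finset ℤ) := by
      intro k hk l hl hkl
      obtain ⟨hk, hkf⟩ := Finset.mem_filter.1 hk
      obtain ⟨hl, hlf⟩ := Finset.mem_filter.1 hl
      exact ((hflag k (hNm k hk) hkf).1).injective (hNm k hk).2 (hNm l hl).2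
        (hkl ▸ (hflag l (hNm l hl) hlf).1)
    rw [h1, ← Finset.sum_image (f := fun k => ‖v (k + 1) - v k‖ₑ ^ τ) h2]
    refine Finset.sum_le_sum_of_subset fun m hm => ?_
    obtain ⟨k, hk, rfl⟩ := Finset.mem_image.1 hm
    obtain ⟨hk, hkf⟩ := Finset.mem_filter.1 hk
    exact (hflag k (hNm k hk) hkf).2.1
  have hpt : ∀ k ∈ N, ‖u (k + 1) - u k‖ₑ ≤
      g k + (‖u k - v (x k)‖ₑ + ‖u (k + 1) - v (x' k)‖ₑ) := by
    intro k hk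
    have h1 : u (k + 1) - u k =
        (v (x' k) - v (x k)) + (-(u k - v (x k)) + (u (k + 1) - v (x' k))) := by ring
    have h2 : ‖v (x' k) - v (x k)‖ₑ = g k := by
      rw [hg]
      by_cases h : flag k
      · simp [h, (hflag k (hNm k hk) h).2.2]
      · simp [h, hnflag k (hNm k hk) h]
    rw [h1, ← h2]
    refine (enorm_add_le _ _).trans (add_le_add_right ((enorm_add_le _ _).trans ?_) _)
    rw [enorm_neg]
  have hτi : 0 ≤ 1 / τ := by positivity
  calc (∑ k ∈ A, ‖u (k + 1) - u k‖ₑ ^ τ) ^ (1 / τ)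
      ≤ (∑ k ∈ N, (g k + (‖u k - v (x k)‖ₑ + ‖u (k + 1) - v (x' k)‖ₑ)) ^ τ) ^ (1 / τ) := by
        rw [hAN]
        gcongr with k hk
        exact hpt k hk
    _ ≤ (∑ k ∈ N, g k ^ τ) ^ (1 / τ) + ((∑ k ∈ N, ‖u k - v (x k)‖ₑ ^ τ) ^ (1 / τ) +
          (∑ k ∈ N, ‖u (k + 1) - v (x' k)‖ₑ ^ τ) ^ (1 / τ)) :=
        (ENNReal.Lp_add_le N _ _ hτ).trans
          (add_le_add_right (ENNReal.Lp_add_le N _ _ hτ) _)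
    _ ≤ _ := by
        rw [two_mul]
        gcongr

/-- The weight attached to a corner `e`: it is `1` within distance `r` of `e` and decays like
`r / |x - e|` further away. -/
def cornerWeight (r : ℝ) (e x : Plane) : ℝ≥0∞ := min 1 (ENNReal.ofReal r / edist x e)

lemma measurable_cornerWeight (r : ℝ) (e : Plane) : Measurable (cornerWeight r e) := by
  unfold cornerWeight
  fun_prop

lemma cornerWeight_le_one (r : ℝ) (e x : Plane) : cornerWeight r e x ≤ 1 := min_le_left _ _

lemma ofReal_inv_le_cornerWeight {r M : ℝ} (hr : 0 < r) (hM : 1 ≤ M) {e x : Plane}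
    (h : dist x e ≤ r * M) : ENNReal.ofReal (1 / M) ≤ cornerWeight r e x := by
  have hM0 : 0 < M := by linarith
  refine le_min ?_ ?_
  · rw [← ENNReal.ofReal_one]
    exact ENNReal.ofReal_le_ofReal ((div_le_one hM0).2 hM)
  · rw [ENNReal.le_div_iff_mul_le (.inr (by simpa using hr)) (.inl (edist_ne_top _ _)), edist_dist,
      ← ENNReal.ofReal_mul (by positivity)]
    refine ENNReal.ofReal_le_ofReal ?_
    rw [one_div, inv_mul_le_iff₀ hM0]
    linarith

lemma lintegral_ball_inv_edist (e : Plane) {ρ : ℝ} (hρ : 0 < ρ) :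
    ∫⁻ x in ball e ρ, (edist x e)⁻¹ = ENNReal.ofReal (2 * Real.pi * ρ) := by
  have h1 : ∫⁻ x in ball e ρ, (edist x e)⁻¹ = ∫⁻ x in ball (0 : Plane) ρ, (‖x‖ₑ)⁻¹ := by
    rw [← lintegral_indicator measurableSet_ball, ← lintegral_indicator measurableSet_ball,
      ← lintegral_add_right_eq_self _ e]
    refine lintegral_congr fun x => ?_
    simp [indicator, mem_ball, dist_eq_norm, edist_eq_enorm_sub]
  have h2 : ∀ᵐ x ∂(volume.restrict (ball (0 : Plane) ρ)), (‖x‖ₑ)⁻¹ = ENNReal.ofReal (‖x‖⁻¹) := by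
    refine ae_restrict_of_ae ?_
    have : ∀ᵐ x : Plane, x ≠ 0 := by simp [ae_iff]
    filter_upwards [this] with x hx
    rw [ENNReal.ofReal_inv_of_pos (norm_pos_iff.2 hx), ofReal_norm]
  have hdim : Module.finrank ℝ Plane = 2 := by simp
  have hint : IntegrableOn (fun x : Plane => ‖x‖⁻¹) (ball (0 : Plane) ρ) := by
    refine (integrableOn_fun_norm_addHaar volume (f := fun y : ℝ => y⁻¹)).2 ?_
    rw [hdim]
    have : IntegrableOn (fun _ : ℝ => (1 : ℝ)) (Ioo 0 ρ) := by simp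
    refine this.congr_fun (fun y hy => ?_) measurableSet_Ioo
    have := hy.1.ne'
    simp [this]
  rw [h1, lintegral_congr_ae h2, ← ofReal_integral_eq_lintegral_ofReal hint
    (Filter.Eventually.of_forall fun x => by positivity)]
  congr 1
  rw [← integral_indicator measurableSet_ball]
  have h3 : (fun x : Plane => (ball (0 : Plane) ρ).indicator (fun x => ‖x‖⁻¹) x) =
      fun x : Plane => (Iio ρ).indicator (fun y : ℝ => y⁻¹) ‖x‖ := by
    ext x
    simp [indicator]
  rw [h3, integral_fun_norm_addHaar volume (fun y => (Iio ρ).indicator (fun y : ℝ => y⁻¹) y), hdim]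
  have h4 : ∫ y in Ioi (0 : ℝ), y ^ (2 - 1) • (Iio ρ).indicator (fun y : ℝ => y⁻¹) y = ρ := by
    have : ∀ y ∈ Ioi (0 : ℝ), y ^ (2 - 1) • (Iio ρ).indicator (fun y : ℝ => y⁻¹) y =
        (Iio ρ).indicator (fun _ => (1 : ℝ)) y := by
      intro y hy
      have : y ≠ 0 := (mem_Ioi.1 hy).ne'
      by_cases h : y < ρ <;> simp [h, this]
    rw [setIntegral_congr_fun measurableSet_Ioi this, setIntegral_indicator measurableSet_Iio]
    simp [hρ.le, Ioi_inter_Iio]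
  rw [h4]
  have h5 : volume.real (ball (0 : Plane) 1) = Real.pi := by
    simp [Measure.real, EuclideanSpace.volume_ball_fin_two, Real.pi_pos.le]
  rw [h5]
  simp
  ring

lemma setLIntegral_cornerWeight_le (r : ℝ) (e : Plane) (U : Set Plane) :
    ∫⁻ x in U, cornerWeight r e x ≤ volume U := by
  refine (lintegral_mono fun x => cornerWeight_le_one r e x).trans ?_
  simp

lemma setLIntegral_cornerWeight_le_sqrt {r : ℝ} (e : Plane) {U : Set Plane}
    (hU : volume U ≠ ∞) :
    ∫⁻ x in U, cornerWeight r e x ≤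
      ENNReal.ofReal ((2 * Real.pi + 1) * r) * volume U ^ (1 / 2 : ℝ) := by
  rcases eq_or_ne (volume U) 0 with h0 | h0
  · rw [Measure.restrict_eq_zero.2 h0]
    simp
  set ρ : ℝ := √(volume U).toReal with hρdef
  have hv : 0 < (volume U).toReal := ENNReal.toReal_pos h0 hU
  have hρ : 0 < ρ := Real.sqrt_pos.2 hv
  have hρ2 : volume U = ENNReal.ofReal (ρ ^ 2) := by
    rw [hρdef, Real.sq_sqrt hv.le, ENNReal.ofReal_toReal hU]
  have h1 : ∫⁻ x in U, (edist x e)⁻¹ ≤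
      ENNReal.ofReal (2 * Real.pi * ρ) + ENNReal.ofReal ρ := by
    rw [← lintegral_inter_add_sdiff _ U (measurableSet_ball : MeasurableSet (ball e ρ))]
    gcongr
    · rw [← lintegral_ball_inv_edist e hρ]
      exact lintegral_mono_set inter_subset_right
    · have : ∀ x ∈ U \ ball e ρ, (edist x e)⁻¹ ≤ ENNReal.ofReal ρ⁻¹ := by
        intro x hx
        rw [ENNReal.ofReal_inv_of_pos hρ, ENNReal.inv_le_inv, edist_dist]
        refine ENNReal.ofReal_le_ofReal ?_
        simpa using hx.2
      refine (setLIntegral_mono measurable_const this).trans ?_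
      rw [setLIntegral_const]
      calc _ ≤ ENNReal.ofReal ρ⁻¹ * volume U := by gcongr; exact sdiff_subset
        _ = ENNReal.ofReal ρ := by
          rw [hρ2, ← ENNReal.ofReal_mul (by positivity)]
          congr 1
          field_simp
  have hU2 : volume U ^ (1 / 2 : ℝ) = ENNReal.ofReal ρ := by
    rw [hρ2, ENNReal.ofReal_rpow_of_nonneg (by positivity) (by norm_num),
      ← Real.sqrt_eq_rpow, Real.sqrt_sq hρ.le]
  calc ∫⁻ x in U, cornerWeight r e x ≤ ∫⁻ x in U, ENNReal.ofReal r * (edist x e)⁻¹ := by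
        refine lintegral_mono fun x => ?_
        exact min_le_right _ _
    _ = ENNReal.ofReal r * ∫⁻ x in U, (edist x e)⁻¹ :=
        lintegral_const_mul _ (by fun_prop)
    _ ≤ ENNReal.ofReal r * (ENNReal.ofReal (2 * Real.pi * ρ) + ENNReal.ofReal ρ) := by gcongr
    _ = _ := by
        have := Real.pi_pos
        rw [hU2, ← ENNReal.ofReal_add (by positivity) hρ.le, mul_comm (2 * Real.pi + 1) r,
          ENNReal.ofReal_mul' (by positivity), mul_assoc (ENNReal.ofReal r),
          ← ENNReal.ofReal_mul (p := 2 * Real.pi + 1) (by positivity)]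
        congr 2
        ring

/-- `P` is a finite set of corners controlling the short chords of `R` up to the constant `C`. -/
def IsCornerSet (C : ℝ) (R : Set Plane) (P : Finset Plane) : Prop :=
  ∀ y ∈ R, ∀ (h : Plane) (l m M : ℝ), 0 ≤ l → l ≤ M → y - l • h ∉ R → 0 ≤ m → m ≤ M →
    y + m • h ∉ R → ∃ e ∈ P, dist y e ≤ C * (M * ‖h‖)

/-- The constant relating short chords of a ring to the distance from its corners. -/
def cornerConst (β : ℝ) : ℝ := 1 + 2 / aperture β

lemma cornerConst_pos {β : ℝ} (hβ : 0 < β) (hβ' : β ≤ Real.pi / 3) : 0 < cornerConst β := by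
  have := aperture_pos hβ hβ'
  unfold cornerConst
  positivity

lemma IsRing.exists_cornerSet {N₀ : ℕ} {c₀ β : ℝ} (hβ : 0 < β) (hβ' : β ≤ Real.pi / 3)
    {R : Set Plane} (H : IsRing N₀ c₀ β R) :
    ∃ P : Finset Plane, P.card ≤ 8 * N₀ ∧ IsCornerSet (cornerConst β) R P := by
  obtain ⟨E, hE, hcov, hgood⟩ := H.exists_half_edges hβ'
  refine ⟨E.image Prod.fst ∪ E.image Prod.snd, ?_, ?_⟩
  · refine (Finset.card_union_le _ _).trans ?_
    have h1 := Finset.card_image_le (s := E) (f := Prod.fst)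
    have h2 := Finset.card_image_le (s := E) (f := Prod.snd)
    omega
  · intro y hy h l m M hl hlM hyl hm hmM hym
    obtain ⟨e, he, h1 | h1⟩ := exists_endpoint_near hβ hβ' hcov hgood hy hl hlM hyl hm hmM hym
    · exact ⟨e.1, by simp only [Finset.mem_union, Finset.mem_image]; exact .inl ⟨e, he, rfl⟩, h1⟩
    · exact ⟨e.2, by simp only [Finset.mem_union, Finset.mem_image]; exact .inr ⟨e, he, rfl⟩, h1⟩

/-- The strip of points whose orthogonal projection to `ℝ h` lies in `[k h, (k + 1) h)`. -/
def strip (h : Plane) (k : ℤ) : Set Plane :=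
  {x | k * ‖h‖ ^ 2 ≤ inner ℝ x h ∧ inner ℝ x h < (k + 1) * ‖h‖ ^ 2}

lemma measurableSet_strip (h : Plane) (k : ℤ) : MeasurableSet (strip h k) := by
  have h1 : Measurable fun x : Plane => (inner ℝ x h : ℝ) :=
    (continuous_id.inner continuous_const).measurable
  exact (measurableSet_le measurable_const h1).inter (measurableSet_lt h1 measurable_const)

lemma mem_strip_iff {h : Plane} (hh : h ≠ 0) {k : ℤ} {x : Plane} :
    x ∈ strip h k ↔ ⌊(inner ℝ x h : ℝ) / ‖h‖ ^ 2⌋ = k := by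
  have : 0 < ‖h‖ ^ 2 := by positivity
  rw [Int.floor_eq_iff, le_div_iff₀ this, div_lt_iff₀ this]
  rfl

/-- An integral over the plane is the integral over a strip of the sum over lattice chains. -/
lemma lintegral_eq_setLIntegral_strip_tsum {h : Plane} (hh : h ≠ 0) {F : Plane → ℝ≥0∞}
    (hF : Measurable F) :
    ∫⁻ x, F x = ∫⁻ x in strip h 0, ∑' k : ℤ, F (x + (k : ℝ) • h) := by
  have hcover : (⋃ k, strip h k) = univ := by
    refine eq_univ_of_forall fun x => mem_iUnion.2 ⟨_, (mem_strip_iff hh).2 rfl⟩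
  have hdisj : Pairwise (Function.onFun Disjoint (strip h)) := by
    intro k l hkl
    refine Set.disjoint_left.2 fun x hk hl => hkl ?_
    rw [← (mem_strip_iff hh).1 hk, ← (mem_strip_iff hh).1 hl]
  rw [lintegral_tsum (f := fun (k : ℤ) x => F (x + (k : ℝ) • h))
      fun k => (hF.comp (measurable_add_const _)).aemeasurable,
    ← setLIntegral_univ, ← hcover, lintegral_iUnion (measurableSet_strip h) hdisj]
  refine tsum_congr fun k => ?_
  rw [← lintegral_indicator (measurableSet_strip h k),
    ← lintegral_indicator (measurableSet_strip h 0),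
    ← lintegral_add_right_eq_self _ ((k : ℝ) • h)]
  refine lintegral_congr fun x => ?_
  have : x + (k : ℝ) • h ∈ strip h k ↔ x ∈ strip h 0 := by
    simp only [strip, mem_ofPred_eq, inner_add_left, real_inner_smul_left,
      real_inner_self_eq_norm_sq]
    push_cast
    constructor <;> rintro ⟨h1, h2⟩ <;> constructor <;> linarith
  by_cases hx : x ∈ strip h 0
  · rw [indicator_of_mem hx, indicator_of_mem (this.2 hx)]
  · rw [indicator_of_notMem hx, indicator_of_notMem (mt this.1 hx)]

/-- The sets `U j` are closed, cover `Ω` up to null overlaps, and the `P j` are sets of at most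
`N` corners of `U j`. -/
structure IsTiling (C : ℝ) (N : ℕ) (Ω : Set Plane) {n : ℕ} (U : Fin n → Set Plane)
    (P : Fin n → Finset Plane) : Prop where
  isClosed : ∀ j, IsClosed (U j)
  null : ∀ i j, i ≠ j → volume (U i ∩ U j) = 0
  iUnion_eq : (⋃ j, U j) = Ω
  corner : ∀ j, IsCornerSet C (U j) (P j)
  card_le : ∀ j, (P j).card ≤ N

/-- The step function with value `c j` on `U j`. -/
def stepFun {n : ℕ} (U : Fin n → Set Plane) (c : Fin n → ℝ) (x : Plane) : ℝ :=
  ∑ j, (U j).indicator (fun _ => c j) x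

/-- The set of points covered by at least two of the sets `U j`. -/
def overlap {n : ℕ} (U : Fin n → Set Plane) : Set Plane :=
  {x | ∃ i j, i ≠ j ∧ x ∈ U i ∧ x ∈ U j}

lemma stepFun_eq {n : ℕ} {U : Fin n → Set Plane} {c : Fin n → ℝ} {x : Plane} {j : Fin n}
    (hx : x ∉ overlap U) (hj : x ∈ U j) : stepFun U c x = c j := by
  unfold stepFun
  rw [Finset.sum_eq_single j, indicator_of_mem hj]
  · intro i _ hij
    refine indicator_of_notMem (fun hi => hx ⟨i, j, hij, hi, hj⟩) _
  · simp

lemma IsTiling.volume_overlap {C : ℝ} {N : ℕ} {Ω : Set Plane} {n : ℕ} {U : Fin n → Set Plane}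
    {P : Fin n → Finset Plane} (H : IsTiling C N Ω U P) : volume (overlap U) = 0 := by
  have : overlap U ⊆ ⋃ i, ⋃ j, ⋃ _ : i ≠ j, U i ∩ U j := by
    rintro x ⟨i, j, hij, hi, hj⟩
    simp only [mem_iUnion]
    exact ⟨i, j, hij, hi, hj⟩
  refine measure_mono_null this ?_
  simp only [measure_iUnion_null_iff]
  exact H.null

lemma IsTiling.measurable_stepFun {C : ℝ} {N : ℕ} {Ω : Set Plane} {n : ℕ} {U : Fin n → Set Plane}
    {P : Fin n → Finset Plane} (H : IsTiling C N Ω U P) (c : Fin n → ℝ) :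
    Measurable (stepFun U c) := by
  unfold stepFun
  exact Finset.measurable_sum _ fun j _ => measurable_const.indicator (H.isClosed j).measurableSet

/-- The weight carried by an intersection of two tiles with corner sets `P` and `Q`. -/
def pairWeight (r : ℝ) (P Q : Finset Plane) (x : Plane) : ℝ≥0∞ :=
  2 * (∑ e ∈ P, cornerWeight r e x + ∑ e ∈ Q, cornerWeight r e x)

lemma measurable_pairWeight (r : ℝ) (P Q : Finset Plane) : Measurable (pairWeight r P Q) := by
  have (P : Finset Plane) : Measurable fun x => ∑ e ∈ P, cornerWeight r e x :=
    Finset.measurable_sum _ fun e _ => measurable_cornerWeight r e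
  exact ((this P).add (this Q)).const_mul 2

/-- The total weight of a pair of tilings. -/
def tilingWeight (r : ℝ) {n : ℕ} (U : Fin n → Set Plane) (P : Fin n → Finset Plane)
    (V : Fin n → Set Plane) (Q : Fin n → Finset Plane) (x : Plane) : ℝ≥0∞ :=
  ∑ q : Fin n × Fin n, (U q.1 ∩ V q.2).indicator (pairWeight r (P q.1) (Q q.2)) x

lemma deltah_one (Ω : Set Plane) (h : Plane) (f : Plane → ℝ) (x : Plane) :
    deltah Ω 1 h f x = if segment ℝ x (x + h) ⊆ Ω then f (x + h) - f x else 0 := by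
  simp only [deltah, Finset.sum_range_succ, Finset.sum_range_zero]
  norm_num
  congr 1
  ring

lemma measurable_deltah_one {Ω : Set Plane} (hΩ : IsClosed Ω) (h : Plane) {f : Plane → ℝ}
    (hf : Measurable f) : Measurable (deltah Ω 1 h f) := by
  have : deltah Ω 1 h f = fun x => if segment ℝ x (x + h) ⊆ Ω then f (x + h) - f x else 0 :=
    funext (deltah_one Ω h f)
  rw [this]
  refine Measurable.ite ?_ ((hf.comp (measurable_add_const h)).sub hf) measurable_const
  have h1 : {x : Plane | segment ℝ x (x + h) ⊆ Ω} =
      ⋂ t ∈ Icc (0 : ℝ) 1, (fun x : Plane => x + t • h) ⁻¹' Ω := by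
    ext x
    simp only [segment_eq_image', add_sub_cancel_left, image_subset_iff, mem_ofPred_eq, mem_iInter]
    rfl
  rw [h1]
  exact (isClosed_biInter fun t _ => hΩ.preimage (by fun_prop)).measurableSet

lemma finite_setOf_add_smul_mem {Ω : Set Plane} (hΩ : Bornology.IsBounded Ω) {h : Plane}
    (hh : h ≠ 0) (x : Plane) : {k : ℤ | x + (k : ℝ) • h ∈ Ω}.Finite := by
  obtain ⟨R, hR⟩ := hΩ.subset_closedBall x
  have h0 : 0 < ‖h‖ := norm_pos_iff.2 hh
  refine (Set.finite_Icc (-⌈R / ‖h‖⌉) ⌈R / ‖h‖⌉).subset fun k hk => ?_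
  have h1 := hR hk
  rw [mem_closedBall, dist_eq_norm, add_sub_cancel_left, norm_smul, ← le_div_iff₀ h0,
    Real.norm_eq_abs, abs_le] at h1
  have h2 := Int.le_ceil (R / ‖h‖)
  constructor
  · have : (-⌈R / ‖h‖⌉ : ℝ) ≤ k := by linarith
    exact_mod_cast this
  · have : (k : ℝ) ≤ ⌈R / ‖h‖⌉ := by linarith
    exact_mod_cast this

lemma IsCornerSet.exists_weight_ge {C : ℝ} (hC : 0 < C) {R : Set Plane} {P : Finset Plane}
    (H : IsCornerSet C R P) {x h : Plane} (hh : h ≠ 0) {a y b : ℤ} (hay : a ≤ y) (hyb : y ≤ b)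
    (hy : x + (y : ℝ) • h ∈ R)
    (ha : ¬ segment ℝ (x + ((a - 1 : ℤ) : ℝ) • h) (x + ((a - 1 : ℤ) : ℝ) • h + h) ⊆ R)
    (hb : ¬ segment ℝ (x + (b : ℝ) • h) (x + (b : ℝ) • h + h) ⊆ R) :
    ENNReal.ofReal (2 / ((b - a + 1 : ℤ) : ℝ)) ≤
      2 * ∑ e ∈ P, cornerWeight (C * ‖h‖) e (x + (y : ℝ) • h) := by
  simp only [segment_eq_image', add_sub_cancel_left, image_subset_iff] at ha hb
  obtain ⟨t, ht, ht'⟩ := Set.not_subset.1 ha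
  obtain ⟨u, hu, hu'⟩ := Set.not_subset.1 hb
  have hay' : (a : ℝ) ≤ y := by exact_mod_cast hay
  have hyb' : (y : ℝ) ≤ b := by exact_mod_cast hyb
  have h0 : 0 < ‖h‖ := norm_pos_iff.2 hh
  obtain ⟨e, he, hd⟩ := H _ hy h (y - (a - 1) - t) (b - y + u) (b - a + 1)
    (by linarith [ht.2]) (by linarith [ht.1])
    (by
      convert ht' using 1
      simp only [mem_preimage]
      congr! 1
      push_cast
      module)
    (by linarith [hu.1]) (by linarith [hu.2])
    (by
      convert hu' using 1
      simp only [mem_preimage]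
      congr! 1
      module)
  have h1 := ofReal_inv_le_cornerWeight (r := C * ‖h‖) (M := b - a + 1) (by positivity)
    (by linarith) (x := x + (y : ℝ) • h) (e := e) (by linarith)
  calc ENNReal.ofReal (2 / ((b - a + 1 : ℤ) : ℝ))
      = 2 * ENNReal.ofReal (1 / ((b : ℝ) - a + 1)) := by
        rw [div_eq_mul_one_div, ENNReal.ofReal_mul (by norm_num)]
        push_cast
        simp
    _ ≤ _ := by
        gcongr
        exact h1.trans (Finset.single_le_sum
          (f := fun e => cornerWeight (C * ‖h‖) e (x + (y : ℝ) • h)) (fun _ _ => zero_le) he)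

section Chain

variable {C : ℝ} {N : ℕ} {Ω : Set Plane} {n : ℕ} {U V : Fin n → Set Plane}
  {P Q : Fin n → Finset Plane}

/-- Comparison of the differences of two step functions along a single lattice chain. -/
lemma IsTiling.tsum_deltah_le (HU : IsTiling C N Ω U P) (HV : IsTiling C N Ω V Q) (hC : 0 < C)
    (hΩ : IsCompact Ω) {τ : ℝ} (hτ : 1 ≤ τ) (c d : Fin n → ℝ) {h : Plane} (hh : h ≠ 0) {x : Plane}
    (hxU : ∀ k : ℤ, x + (k : ℝ) • h ∉ overlap U) (hxV : ∀ k : ℤ, x + (k : ℝ) • h ∉ overlap V) :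
    (∑' k : ℤ, ‖deltah Ω 1 h (stepFun U c) (x + (k : ℝ) • h)‖ₑ ^ τ) ^ (1 / τ) ≤
      (∑' k : ℤ, ‖deltah Ω 1 h (stepFun V d) (x + (k : ℝ) • h)‖ₑ ^ τ) ^ (1 / τ) +
      2 * (∑' k : ℤ, ‖stepFun U c (x + (k : ℝ) • h) - stepFun V d (x + (k : ℝ) • h)‖ₑ ^ τ *
        tilingWeight (C * ‖h‖) U P V Q (x + (k : ℝ) • h)) ^ (1 / τ) := by
  have hτ0 : 0 < τ := by linarith
  set y : ℤ → Plane := fun k => x + (k : ℝ) • h with hy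
  have hsucc (k : ℤ) : y k + h = y (k + 1) := by
    simp only [hy]
    push_cast
    module
  have hBfin : {k | y k ∈ Ω}.Finite := finite_setOf_add_smul_mem hΩ.isBounded hh x
  have hAB : {k | segment ℝ (y k) (y k + h) ⊆ Ω} ⊆ {k | y k ∈ Ω} :=
    fun k hk => hk (left_mem_segment _ _ _)
  set B : Finset ℤ := hBfin.toFinset with hB
  set A : Finset ℤ := (hBfin.subset hAB).toFinset with hA
  have hmemA (k : ℤ) : k ∈ A ↔ segment ℝ (y k) (y k + h) ⊆ Ω := by simp [hA]
  have hmemB (k : ℤ) : k ∈ B ↔ y k ∈ Ω := by simp [hB]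
  have hsum (f : Plane → ℝ) : ∑' k : ℤ, ‖deltah Ω 1 h f (y k)‖ₑ ^ τ =
      ∑ k ∈ A, ‖f (y (k + 1)) - f (y k)‖ₑ ^ τ := by
    rw [tsum_eq_sum (s := A)]
    · refine Finset.sum_congr rfl fun k hk => ?_
      rw [deltah_one, if_pos ((hmemA k).1 hk), hsucc]
    · intro k hk
      rw [deltah_one, if_neg (mt (hmemA k).2 hk)]
      simp [hτ0]
  have hL {W : Fin n → Set Plane} (hW : (⋃ j, W j) = Ω) :
      {k | ∃ j, segment ℝ (y k) (y k + h) ⊆ W j} ⊆ A := by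
    rintro k ⟨j, hj⟩
    rw [Finset.mem_coe, hmemA, ← hW]
    exact hj.trans (subset_iUnion _ _)
  have heq {W : Fin n → Set Plane} (hW : ∀ k, y k ∉ overlap W) (w : Fin n → ℝ) :
      ∀ k ∈ {k | ∃ j, segment ℝ (y k) (y k + h) ⊆ W j},
        stepFun W w (y (k + 1)) = stepFun W w (y k) := by
    rintro k ⟨j, hj⟩
    rw [stepFun_eq (hW k) (hj (left_mem_segment _ _ _)),
      stepFun_eq (hW (k + 1)) (hsucc k ▸ hj (right_mem_segment _ _ _))]
  have hweight (i j : Fin n) (k : ℤ) (hi : y k ∈ U i) (hj : y k ∈ V j) :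
      pairWeight (C * ‖h‖) (P i) (Q j) (y k) ≤ tilingWeight (C * ‖h‖) U P V Q (y k) := by
    refine le_trans (le_of_eq ?_) (Finset.single_le_sum (f := fun q : Fin n × Fin n =>
      (U q.1 ∩ V q.2).indicator (pairWeight (C * ‖h‖) (P q.1) (Q q.2)) (y k))
      (fun _ _ => zero_le) (Finset.mem_univ (i, j)))
    have : y k ∈ U i ∩ V j := ⟨hi, hj⟩
    simp only [indicator_of_mem this]
  rw [hsum, hsum]
  refine (chain_variation_le hτ (hL HU.iUnion_eq) (hL HV.iUnion_eq) (B := B)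
    (u := fun k => stepFun U c (y k))
    (v := fun k => stepFun V d (y k)) ?_ (heq hxU c) (heq hxV d) (φ := fun k => tilingWeight (C * ‖h‖) U P V Q (y k)) ?_ ?_).trans ?_
  · intro k hk
    rw [hmemA] at hk
    rw [hmemB, hmemB, ← hsucc]
    exact ⟨hk (left_mem_segment _ _ _), hk (right_mem_segment _ _ _)⟩
  · intro k hk a b hak hkb ha hb
    rw [hmemB] at hk
    obtain ⟨i, hi⟩ := mem_iUnion.1 (HU.iUnion_eq.ge hk)
    obtain ⟨j, hj⟩ := mem_iUnion.1 (HV.iUnion_eq.ge hk)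
    refine ((HU.corner i).exists_weight_ge hC hh hak hkb hi (fun h' => ha ⟨i, h'⟩)
      (fun h' => hb ⟨i, h'⟩)).trans (le_trans ?_ (hweight i j k hi hj))
    unfold pairWeight
    gcongr
    exact le_self_add
  · intro k hk a b hak hkb ha hb
    rw [hmemB] at hk
    obtain ⟨i, hi⟩ := mem_iUnion.1 (HU.iUnion_eq.ge hk)
    obtain ⟨j, hj⟩ := mem_iUnion.1 (HV.iUnion_eq.ge hk)
    refine ((HV.corner j).exists_weight_ge hC hh hak hkb hj (fun h' => ha ⟨j, h'⟩)
      (fun h' => hb ⟨j, h'⟩)).trans (le_trans ?_ (hweight i j k hi hj))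
    unfold pairWeight
    gcongr
    exact le_add_self
  · gcongr
    exact ENNReal.sum_le_tsum B

lemma lpNormE_rpow_eq {τ : ℝ} (hτ : 0 < τ) (Ω : Set Plane) (f : Plane → ℝ) :
    lpNormE τ Ω f = (∫⁻ x in Ω, ‖f x‖ₑ ^ τ) ^ (1 / τ) := by
  unfold lpNormE
  rw [eLpNorm_eq_lintegral_rpow_enorm_toReal (by simpa using hτ) ENNReal.ofReal_ne_top,
    ENNReal.toReal_ofReal hτ.le]

lemma lpNormE_deltah_one {τ : ℝ} (hτ : 0 < τ) (hΩ : MeasurableSet Ω) (h : Plane) (f : Plane → ℝ) :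
    lpNormE τ Ω (deltah Ω 1 h f) = (∫⁻ x, ‖deltah Ω 1 h f x‖ₑ ^ τ) ^ (1 / τ) := by
  rw [lpNormE_rpow_eq hτ, ← lintegral_indicator hΩ]
  congr 2
  ext x
  by_cases hx : x ∈ Ω
  · rw [indicator_of_mem hx]
  · rw [indicator_of_notMem hx, deltah_one, if_neg fun h' => hx (h' (left_mem_segment _ _ _))]
    simp [hτ]

lemma IsTiling.ae_notMem_overlap (HU : IsTiling C N Ω U P) (h : Plane) :
    ∀ᵐ x, ∀ k : ℤ, x + (k : ℝ) • h ∉ overlap U := by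
  rw [ae_all_iff]
  intro k
  have h1 : ∀ᵐ x, x ∉ overlap U := by
    rw [ae_iff]
    simpa using HU.volume_overlap
  exact (measurePreserving_add_right volume ((k : ℝ) • h)).quasiMeasurePreserving.ae h1

lemma IsTiling.measurable_tilingWeight (HU : IsTiling C N Ω U P) (HV : IsTiling C N Ω V Q)
    (r : ℝ) : Measurable (tilingWeight r U P V Q) :=
  Finset.measurable_sum _ fun q _ => (measurable_pairWeight _ _ _).indicator
    ((HU.isClosed q.1).measurableSet.inter (HV.isClosed q.2).measurableSet)

lemma IsTiling.lpNormE_deltah_le (HU : IsTiling C N Ω U P) (HV : IsTiling C N Ω V Q) (hC : 0 < C)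
    (hΩ : IsCompact Ω) {τ : ℝ} (hτ : 1 ≤ τ) (c d : Fin n → ℝ) {h : Plane} (hh : h ≠ 0) :
    lpNormE τ Ω (deltah Ω 1 h (stepFun U c)) ≤ lpNormE τ Ω (deltah Ω 1 h (stepFun V d)) +
      2 * (∫⁻ x, ‖stepFun U c x - stepFun V d x‖ₑ ^ τ *
        tilingWeight (C * ‖h‖) U P V Q x) ^ (1 / τ) := by
  have hτ0 : 0 < τ := by linarith
  have hm := hΩ.isClosed.measurableSet
  have hmU : Measurable fun x => ‖deltah Ω 1 h (stepFun U c) x‖ₑ ^ τ :=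
    (measurable_deltah_one hΩ.isClosed h (HU.measurable_stepFun c)).enorm.pow_const τ
  have hmV : Measurable fun x => ‖deltah Ω 1 h (stepFun V d) x‖ₑ ^ τ :=
    (measurable_deltah_one hΩ.isClosed h (HV.measurable_stepFun d)).enorm.pow_const τ
  have hmD : Measurable fun x => ‖stepFun U c x - stepFun V d x‖ₑ ^ τ *
        tilingWeight (C * ‖h‖) U P V Q x :=
    (((HU.measurable_stepFun c).sub (HV.measurable_stepFun d)).enorm.pow_const τ).mul
      (HU.measurable_tilingWeight HV _)
  rw [lpNormE_deltah_one hτ0 hm, lpNormE_deltah_one hτ0 hm,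
    lintegral_eq_setLIntegral_strip_tsum hh hmU, lintegral_eq_setLIntegral_strip_tsum hh hmV,
    lintegral_eq_setLIntegral_strip_tsum hh hmD]
  have hmT {F : Plane → ℝ≥0∞} (hF : Measurable F) :
      Measurable fun x => (∑' k : ℤ, F (x + (k : ℝ) • h)) ^ (1 / τ) :=
    (Measurable.tsum fun k => hF.comp (measurable_add_const _)).pow_const _
  have hroot (a : ℝ≥0∞) : (a ^ (1 / τ)) ^ τ = a := by
    rw [← ENNReal.rpow_mul, one_div_mul_cancel hτ0.ne', ENNReal.rpow_one]
  have hpt : ∀ᵐ x, (∑' k : ℤ, ‖deltah Ω 1 h (stepFun U c) (x + (k : ℝ) • h)‖ₑ ^ τ) ≤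
      ((∑' k : ℤ, ‖deltah Ω 1 h (stepFun V d) (x + (k : ℝ) • h)‖ₑ ^ τ) ^ (1 / τ) +
      2 * (∑' k : ℤ, ‖stepFun U c (x + (k : ℝ) • h) - stepFun V d (x + (k : ℝ) • h)‖ₑ ^ τ *
        tilingWeight (C * ‖h‖) U P V Q (x + (k : ℝ) • h)) ^ (1 / τ)) ^ τ := by
    filter_upwards [HU.ae_notMem_overlap h, HV.ae_notMem_overlap h] with x hxU hxV
    rw [← hroot (∑' k : ℤ, ‖deltah Ω 1 h (stepFun U c) (x + (k : ℝ) • h)‖ₑ ^ τ)]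
    gcongr
    exact HU.tsum_deltah_le HV hC hΩ hτ c d hh hxU hxV
  refine (ENNReal.rpow_le_rpow (lintegral_mono_ae (ae_restrict_of_ae hpt))
    (by positivity)).trans ?_
  refine (ENNReal.lintegral_Lp_add_le (hmT hmV).aemeasurable
    ((hmT hmD).const_mul 2).aemeasurable hτ).trans ?_
  refine add_le_add (le_of_eq ?_) (le_of_eq ?_)
  · simp only [hroot]
  · simp only [ENNReal.mul_rpow_of_nonneg _ _ hτ0.le, hroot]
    rw [lintegral_const_mul _ (by
        simpa only [hroot] using (hmT hmD).pow_const τ),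
      ENNReal.mul_rpow_of_nonneg _ _ (by positivity), ← ENNReal.rpow_mul,
      mul_one_div_cancel hτ0.ne', ENNReal.rpow_one]

end Chain

section Weights

variable {C : ℝ} {N : ℕ} {Ω : Set Plane} {n : ℕ} {U V : Fin n → Set Plane}
  {P Q : Fin n → Finset Plane}

lemma notMem_overlap_unique {x : Plane} (hxU : x ∉ overlap U) (hxV : x ∉ overlap V)
    {q q' : Fin n × Fin n} (hq : x ∈ U q.1 ∩ V q.2) (hq' : x ∈ U q'.1 ∩ V q'.2) : q' = q := by
  refine Prod.ext ?_ ?_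
  · by_contra h
    exact hxU ⟨_, _, h, hq'.1, hq.1⟩
  · by_contra h
    exact hxV ⟨_, _, h, hq'.2, hq.2⟩

lemma IsTiling.ae_notMem_overlap_self (HU : IsTiling C N Ω U P) : ∀ᵐ x, x ∉ overlap U := by
  rw [ae_iff]
  simpa using HU.volume_overlap

lemma setLIntegral_pairWeight_le {t : ℝ} {h : Plane} (hC : 0 < C) (ht : ‖h‖ ≤ t)
    {P Q : Finset Plane} (hP : P.card ≤ N) (hQ : Q.card ≤ N) {A : Set Plane}
    (hA : volume A ≠ ∞) :
    ∫⁻ x in A, pairWeight (C * ‖h‖) P Q x ≤ 4 * N *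
      min (volume A) (ENNReal.ofReal ((2 * Real.pi + 1) * C * t) * volume A ^ (1 / 2 : ℝ)) := by
  have hone (e : Plane) : ∫⁻ x in A, cornerWeight (C * ‖h‖) e x ≤
      min (volume A) (ENNReal.ofReal ((2 * Real.pi + 1) * C * t) * volume A ^ (1 / 2 : ℝ)) := by
    refine le_min (setLIntegral_cornerWeight_le _ _ _)
      ((setLIntegral_cornerWeight_le_sqrt e hA).trans ?_)
    have := Real.pi_pos
    rw [mul_assoc (2 * Real.pi + 1)]
    gcongr
  set m := min (volume A)
    (ENNReal.ofReal ((2 * Real.pi + 1) * C * t) * volume A ^ (1 / 2 : ℝ))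
  have hsum {P : Finset Plane} (hP : P.card ≤ N) :
      ∫⁻ x in A, ∑ e ∈ P, cornerWeight (C * ‖h‖) e x ≤ N * m := by
    rw [lintegral_finsetSum _ fun e _ => measurable_cornerWeight _ e]
    refine (Finset.sum_le_card_nsmul _ _ m fun e _ => hone e).trans ?_
    rw [nsmul_eq_mul]
    gcongr
  have hmeas (P : Finset Plane) : Measurable fun x => ∑ e ∈ P, cornerWeight (C * ‖h‖) e x :=
    Finset.measurable_sum _ fun e _ => measurable_cornerWeight _ e
  unfold pairWeight
  rw [lintegral_const_mul 2 (f := fun x => ∑ e ∈ P, cornerWeight (C * ‖h‖) e x +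
    ∑ e ∈ Q, cornerWeight (C * ‖h‖) e x) ((hmeas P).add (hmeas Q)), lintegral_add_left (hmeas P)]
  calc _ ≤ 2 * (N * m + N * m) := by
        gcongr
        · exact hsum hP
        · exact hsum hQ
    _ = _ := by ring

lemma IsTiling.lintegral_mul_tilingWeight_le (HU : IsTiling C N Ω U P) (HV : IsTiling C N Ω V Q)
    (hC : 0 < C) (hΩ : IsCompact Ω) {τ : ℝ} (c d : Fin n → ℝ) {h : Plane} {t : ℝ}
    (ht : ‖h‖ ≤ t) :
    ∫⁻ x, ‖stepFun U c x - stepFun V d x‖ₑ ^ τ * tilingWeight (C * ‖h‖) U P V Q x ≤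
      ∑ q : Fin n × Fin n, ‖c q.1 - d q.2‖ₑ ^ τ * (4 * N * min (volume (U q.1 ∩ V q.2))
        (ENNReal.ofReal ((2 * Real.pi + 1) * C * t) *
          volume (U q.1 ∩ V q.2) ^ (1 / 2 : ℝ))) := by
  have hm (q : Fin n × Fin n) : MeasurableSet (U q.1 ∩ V q.2) :=
    (HU.isClosed q.1).measurableSet.inter (HV.isClosed q.2).measurableSet
  have hfin (q : Fin n × Fin n) : volume (U q.1 ∩ V q.2) ≠ ∞ := by
    refine measure_ne_top_of_subset ?_ hΩ.measure_ne_top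
    exact inter_subset_left.trans (HU.iUnion_eq ▸ subset_iUnion U q.1)
  calc _ = ∫⁻ x, ∑ q : Fin n × Fin n, ‖c q.1 - d q.2‖ₑ ^ τ *
        (U q.1 ∩ V q.2).indicator (pairWeight (C * ‖h‖) (P q.1) (Q q.2)) x := by
        refine lintegral_congr_ae ?_
        filter_upwards [HU.ae_notMem_overlap_self, HV.ae_notMem_overlap_self] with x hxU hxV
        simp only [tilingWeight]
        rw [Finset.mul_sum]
        refine Finset.sum_congr rfl fun q _ => ?_
        by_cases hq : x ∈ U q.1 ∩ V q.2
        · rw [stepFun_eq hxU hq.1, stepFun_eq hxV hq.2]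
        · simp [indicator_of_notMem hq]
    _ = ∑ q : Fin n × Fin n, ‖c q.1 - d q.2‖ₑ ^ τ *
        ∫⁻ x in U q.1 ∩ V q.2, pairWeight (C * ‖h‖) (P q.1) (Q q.2) x := by
        rw [lintegral_finsetSum _ fun q _ =>
          ((measurable_pairWeight _ _ _).indicator (hm q)).const_mul _]
        refine Finset.sum_congr rfl fun q _ => ?_
        rw [lintegral_const_mul _ ((measurable_pairWeight _ _ _).indicator (hm q)),
          lintegral_indicator (hm q)]
    _ ≤ _ := by
        gcongr with q
        exact setLIntegral_pairWeight_le hC ht (HU.card_le _) (HV.card_le _) (hfin q)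

lemma IsTiling.sum_mul_volume_le (HU : IsTiling C N Ω U P) (HV : IsTiling C N Ω V Q)
    {p : ℝ} (c d : Fin n → ℝ) :
    ∑ q : Fin n × Fin n, ‖c q.1 - d q.2‖ₑ ^ p * volume (U q.1 ∩ V q.2) ≤
      ∫⁻ x in Ω, ‖stepFun U c x - stepFun V d x‖ₑ ^ p := by
  have hm (q : Fin n × Fin n) : MeasurableSet (U q.1 ∩ V q.2) :=
    (HU.isClosed q.1).measurableSet.inter (HV.isClosed q.2).measurableSet
  have hsub (q : Fin n × Fin n) : U q.1 ∩ V q.2 ⊆ Ω :=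
    inter_subset_left.trans (HU.iUnion_eq ▸ subset_iUnion U q.1)
  calc _ = ∫⁻ x in Ω, ∑ q : Fin n × Fin n,
        (U q.1 ∩ V q.2).indicator (fun _ => ‖c q.1 - d q.2‖ₑ ^ p) x := by
        rw [lintegral_finsetSum _ fun q _ => measurable_const.indicator (hm q)]
        refine Finset.sum_congr rfl fun q _ => ?_
        rw [lintegral_indicator_const (hm q), Measure.restrict_apply (hm q),
          inter_eq_self_of_subset_left (hsub q)]
    _ ≤ _ := by
        refine lintegral_mono_ae (ae_restrict_of_ae ?_)
        filter_upwards [HU.ae_notMem_overlap_self, HV.ae_notMem_overlap_self] with x hxU hxV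
        by_cases hx : ∃ q : Fin n × Fin n, x ∈ U q.1 ∩ V q.2
        · obtain ⟨q, hq⟩ := hx
          rw [Finset.sum_eq_single q, indicator_of_mem hq, stepFun_eq hxU hq.1,
            stepFun_eq hxV hq.2]
          · intro q' _ hne
            exact indicator_of_notMem (fun h' => hne (notMem_overlap_unique hxU hxV hq h')) _
          · simp
        · rw [Finset.sum_eq_zero]
          · exact zero_le
          · intro q _
            exact indicator_of_notMem (fun h' => hx ⟨q, h'⟩) _

lemma IsTiling.modulus_le (HU : IsTiling C N Ω U P) (HV : IsTiling C N Ω V Q)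
    (hC : 0 < C) (hΩ : IsCompact Ω) {τ : ℝ} (hτ : 1 ≤ τ) (c d : Fin n → ℝ) (t : ℝ) :
    modulus Ω 1 τ (stepFun U c) t ≤ modulus Ω 1 τ (stepFun V d) t +
      2 * (∑ q : Fin n × Fin n, ‖c q.1 - d q.2‖ₑ ^ τ * (4 * N * min (volume (U q.1 ∩ V q.2))
        (ENNReal.ofReal ((2 * Real.pi + 1) * C * t) *
          volume (U q.1 ∩ V q.2) ^ (1 / 2 : ℝ)))) ^ (1 / τ) := by
  refine iSup₂_le fun h ht => ?_
  rcases eq_or_ne h 0 with rfl | hh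
  · have : deltah Ω 1 0 (stepFun U c) = 0 := by
      ext x
      simp [deltah_one]
    rw [this]
    simp [lpNormE]
  refine (HU.lpNormE_deltah_le HV hC hΩ hτ c d hh).trans ?_
  gcongr
  · exact le_iSup₂ (f := fun (h : Plane) (_ : ‖h‖ ≤ t) =>
      lpNormE τ Ω (deltah Ω 1 h (stepFun V d))) h ht
  · exact HU.lintegral_mul_tilingWeight_le HV hC hΩ c d ht

end Weights

/-- The constant in the Besov time integral of a truncated linear weight. -/
def timeConst (K σ : ℝ) : ℝ := K / (1 - σ) + 1 / σ

lemma timeConst_pos {K σ : ℝ} (hK : 0 ≤ K) (hσ : 0 < σ) (hσ' : σ < 1) : 0 < timeConst K σ := by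
  have : 0 < 1 - σ := by linarith
  unfold timeConst
  positivity

lemma setLIntegral_rpow_mul_min_le {K σ ρ : ℝ} (hK : 0 ≤ K) (hσ : 0 < σ) (hσ' : σ < 1)
    (hρ : 0 < ρ) :
    ∫⁻ t in Ioi (0 : ℝ), ENNReal.ofReal (t ^ (-σ - 1)) *
      min (ENNReal.ofReal (ρ ^ 2)) (ENNReal.ofReal (K * t) * ENNReal.ofReal ρ) ≤
      ENNReal.ofReal (timeConst K σ * ρ ^ (2 - σ)) := by
  have h1 : ∫⁻ t in Ioc 0 ρ, ENNReal.ofReal (t ^ (-σ - 1)) *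
      min (ENNReal.ofReal (ρ ^ 2)) (ENNReal.ofReal (K * t) * ENNReal.ofReal ρ) ≤
      ENNReal.ofReal (K / (1 - σ) * ρ ^ (2 - σ)) := by
    have hint : IntegrableOn (fun t : ℝ => K * ρ * t ^ (-σ)) (Ioc 0 ρ) :=
      ((intervalIntegrable_iff_integrableOn_Ioc_of_le hρ.le).1
        (intervalIntegral.intervalIntegrable_rpow' (by linarith))).const_mul _
    calc _ ≤ ∫⁻ t in Ioc 0 ρ, ENNReal.ofReal (K * ρ * t ^ (-σ)) := by
          refine setLIntegral_mono' measurableSet_Ioc fun t ht => ?_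
          have ht0 : 0 < t := ht.1
          refine (mul_le_mul_right (min_le_right _ _) _).trans (le_of_eq ?_)
          rw [← ENNReal.ofReal_mul (by positivity), ← ENNReal.ofReal_mul (by positivity),
            Real.rpow_sub_one ht0.ne']
          congr 1
          field_simp
      _ = ENNReal.ofReal (∫ t in Ioc 0 ρ, K * ρ * t ^ (-σ)) := by
          refine (ofReal_integral_eq_lintegral_ofReal hint ?_).symm
          refine (ae_restrict_iff' measurableSet_Ioc).2 (Filter.Eventually.of_forall fun t ht => ?_)
          have ht0 : 0 < t := ht.1
          simp only [Pi.zero_apply]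
          positivity
      _ = _ := by
          rw [integral_const_mul, ← intervalIntegral.integral_of_le hρ.le,
            integral_rpow (.inl (by linarith)), Real.zero_rpow (by linarith), sub_zero]
          congr 1
          rw [show -σ + 1 = 1 - σ by ring, show 2 - σ = 1 - σ + 1 by ring,
            Real.rpow_add_one hρ.ne']
          generalize ρ ^ (1 - σ) = z
          ring
  have h2 : ∫⁻ t in Ioi ρ, ENNReal.ofReal (t ^ (-σ - 1)) *
      min (ENNReal.ofReal (ρ ^ 2)) (ENNReal.ofReal (K * t) * ENNReal.ofReal ρ) ≤
      ENNReal.ofReal (1 / σ * ρ ^ (2 - σ)) := by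
    have hint : IntegrableOn (fun t : ℝ => ρ ^ 2 * t ^ (-σ - 1)) (Ioi ρ) :=
      (integrableOn_Ioi_rpow_of_lt (by linarith) hρ).const_mul _
    calc _ ≤ ∫⁻ t in Ioi ρ, ENNReal.ofReal (ρ ^ 2 * t ^ (-σ - 1)) := by
          refine setLIntegral_mono' measurableSet_Ioi fun t ht => ?_
          have ht0 : 0 < t := hρ.trans ht
          refine (mul_le_mul_right (min_le_left _ _) _).trans (le_of_eq ?_)
          rw [← ENNReal.ofReal_mul (by positivity), mul_comm]
      _ = ENNReal.ofReal (∫ t in Ioi ρ, ρ ^ 2 * t ^ (-σ - 1)) := by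
          refine (ofReal_integral_eq_lintegral_ofReal hint ?_).symm
          refine (ae_restrict_iff' measurableSet_Ioi).2 (Filter.Eventually.of_forall fun t ht => ?_)
          have ht0 : 0 < t := hρ.trans ht
          simp only [Pi.zero_apply]
          positivity
      _ = _ := by
          rw [integral_const_mul, integral_Ioi_rpow_of_lt (by linarith) hρ]
          congr 1
          rw [show 2 - σ = -σ + (2 : ℕ) by push_cast; ring, Real.rpow_add_natCast hρ.ne',
            show -σ - 1 + 1 = -σ by ring]
          field_simp
  have : 0 < 1 - σ := by linarith
  rw [← Ioc_union_Ioi_eq_Ioi hρ.le,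
    lintegral_union measurableSet_Ioi (Set.disjoint_left.2 fun x hx hx' => not_lt.2 hx.2 hx')]
  refine (add_le_add h1 h2).trans (le_of_eq ?_)
  rw [← ENNReal.ofReal_add (by positivity) (by positivity), ← add_mul]
  rfl

lemma setLIntegral_rpow_mul_min_volume_le {K σ : ℝ} (hK : 0 ≤ K) (hσ : 0 < σ) (hσ' : σ < 1)
    {a : ℝ≥0∞} (ha : a ≠ ∞) :
    ∫⁻ t in Ioi (0 : ℝ), ENNReal.ofReal (t ^ (-σ - 1)) *
      min a (ENNReal.ofReal (K * t) * a ^ (1 / 2 : ℝ)) ≤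
      ENNReal.ofReal (timeConst K σ) * a ^ (1 - σ / 2) := by
  rcases eq_or_ne a 0 with rfl | h0
  · simp
  set ρ : ℝ := √a.toReal with hρdef
  have hv : 0 < a.toReal := ENNReal.toReal_pos h0 ha
  have hρ : 0 < ρ := Real.sqrt_pos.2 hv
  have hρ2 : a = ENNReal.ofReal (ρ ^ 2) := by
    rw [hρdef, Real.sq_sqrt hv.le, ENNReal.ofReal_toReal ha]
  have hhalf : a ^ (1 / 2 : ℝ) = ENNReal.ofReal ρ := by
    rw [hρ2, ENNReal.ofReal_rpow_of_nonneg (by positivity) (by norm_num),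
      ← Real.sqrt_eq_rpow, Real.sqrt_sq hρ.le]
  have hpow : a ^ (1 - σ / 2) = ENNReal.ofReal (ρ ^ (2 - σ)) := by
    rw [hρ2, ENNReal.ofReal_rpow_of_nonneg (by positivity) (by linarith),
      ← Real.rpow_natCast_mul hρ.le]
    congr 2
    push_cast
    ring
  have := setLIntegral_rpow_mul_min_le hK hσ hσ' hρ
  rwa [hpow, ← ENNReal.ofReal_mul (timeConst_pos hK hσ hσ').le, hhalf, hρ2]

lemma measurable_modulus (Ω : Set Plane) (k : ℕ) (τ : ℝ) (f : Plane → ℝ) :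
    Measurable (modulus Ω k τ f) := by
  refine Monotone.measurable fun t t' htt' => ?_
  exact iSup₂_le fun h hh => le_iSup₂ (f := fun (h : Plane) (_ : ‖h‖ ≤ t') =>
    lpNormE τ Ω (deltah Ω k h f)) h (hh.trans htt')

lemma besovSeminorm_eq {Ω : Set Plane} {k : ℕ} {s τ : ℝ} (hτ : 0 < τ) (f : Plane → ℝ) :
    besovSeminorm Ω k s τ f = (∫⁻ t in Ioi (0 : ℝ),
      (ENNReal.ofReal (t ^ (-s)) * (ENNReal.ofReal t)⁻¹ ^ (1 / τ) * modulus Ω k τ f t) ^ τ)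
        ^ (1 / τ) := by
  unfold besovSeminorm
  congr 2
  ext t
  rw [mul_right_comm, ENNReal.mul_rpow_of_nonneg _ ((ENNReal.ofReal t)⁻¹ ^ (1 / τ)) hτ.le,
    ← ENNReal.rpow_mul, one_div_mul_cancel hτ.ne', ENNReal.rpow_one, div_eq_mul_inv]

/-- Minkowski's inequality for the time integral defining the Besov seminorm. -/
lemma besovSeminorm_le_add {Ω : Set Plane} {k : ℕ} {s τ : ℝ} (hτ : 1 ≤ τ) {f g : Plane → ℝ}
    {G : ℝ → ℝ≥0∞} (hG : Measurable G)
    (h : ∀ t, modulus Ω k τ f t ≤ modulus Ω k τ g t + 2 * G t ^ (1 / τ)) :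
    besovSeminorm Ω k s τ f ≤ besovSeminorm Ω k s τ g +
      2 * (∫⁻ t in Ioi (0 : ℝ), ENNReal.ofReal (t ^ (-(s * τ) - 1)) * G t) ^ (1 / τ) := by
  have hτ0 : 0 < τ := by linarith
  set w : ℝ → ℝ≥0∞ := fun t => ENNReal.ofReal (t ^ (-s)) * (ENNReal.ofReal t)⁻¹ ^ (1 / τ) with hw
  have hwm : Measurable w := by
    simp only [hw]
    fun_prop
  have hwτ : ∀ t ∈ Ioi (0 : ℝ), w t ^ τ = ENNReal.ofReal (t ^ (-(s * τ) - 1)) := by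
    intro t ht
    have ht0 : 0 < t := ht
    simp only [hw]
    rw [ENNReal.mul_rpow_of_nonneg _ _ hτ0.le, ← ENNReal.rpow_mul, one_div_mul_cancel hτ0.ne',
      ENNReal.rpow_one, ENNReal.ofReal_rpow_of_nonneg (by positivity) hτ0.le,
      ← ENNReal.ofReal_inv_of_pos ht0, ← ENNReal.ofReal_mul (by positivity), ← Real.rpow_mul ht0.le,
      Real.rpow_sub_one ht0.ne', neg_mul, div_eq_mul_inv]
  rw [besovSeminorm_eq hτ0, besovSeminorm_eq hτ0]
  calc _ ≤ (∫⁻ t in Ioi (0 : ℝ), (w t * modulus Ω k τ g t + w t * (2 * G t ^ (1 / τ))) ^ τ)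
        ^ (1 / τ) := by
        gcongr with t
        rw [← mul_add]
        gcongr
        exact h t
    _ ≤ _ := ENNReal.lintegral_Lp_add_le (hwm.mul (measurable_modulus _ _ _ _)).aemeasurable
        (hwm.mul ((hG.pow_const _).const_mul 2)).aemeasurable hτ
    _ = _ := by
        congr 1
        have : ∀ t ∈ Ioi (0 : ℝ), (w t * (2 * G t ^ (1 / τ))) ^ τ =
            2 ^ τ * (ENNReal.ofReal (t ^ (-(s * τ) - 1)) * G t) := by
          intro t ht
          rw [ENNReal.mul_rpow_of_nonneg _ _ hτ0.le, hwτ t ht,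
            ENNReal.mul_rpow_of_nonneg _ _ hτ0.le,
            ← ENNReal.rpow_mul, one_div_mul_cancel hτ0.ne', ENNReal.rpow_one]
          ring
        rw [setLIntegral_congr_fun measurableSet_Ioi this, lintegral_const_mul _ (by fun_prop),
          ENNReal.mul_rpow_of_nonneg _ _ (by positivity), ← ENNReal.rpow_mul,
          mul_one_div_cancel hτ0.ne', ENNReal.rpow_one]

lemma MvPolynomial.eval_eq_of_totalDegree_lt_one {σ : Type*} {P : MvPolynomial σ ℝ}
    (hP : P.totalDegree < 1) (x : σ → ℝ) : MvPolynomial.eval x P = MvPolynomial.coeff 0 P := by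
  rw [(MvPolynomial.totalDegree_eq_zero_iff_eq_C).1 (Nat.lt_one_iff.1 hP)]
  simp

/-- A spline of order one over a compact set is a step function over a tiling. -/
lemma IsSpline.exists_tiling {N₀ : ℕ} {c₀ β : ℝ} (hβ : 0 < β) (hβ' : β ≤ Real.pi / 3) {n : ℕ}
    {Ω : Set Plane} (hΩ : IsCompact Ω) {S : Plane → ℝ} (hS : IsSpline N₀ c₀ β n 1 Ω S) :
    ∃ (U : Fin n → Set Plane) (P : Fin n → Finset Plane) (c : Fin n → ℝ),
      (∀ j, IsRing N₀ c₀ β (U j)) ∧ (∀ i j, i ≠ j → interior (U i) ∩ interior (U j) = ∅) ∧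
      IsTiling (cornerConst β) (8 * N₀) Ω U P ∧ S = stepFun U c := by
  obtain ⟨U, p, hU, hdisj, hcov, hdeg, rfl, -⟩ := hS
  choose P hPcard hP using fun j => (hU j).exists_cornerSet hβ hβ'
  refine ⟨U, P, fun j => MvPolynomial.coeff 0 (p j), hU, hdisj, ⟨fun j => (hU j).isCompact.isClosed,
    fun i j hij => (hU i).volume_inter (hU j) (hdisj i j hij), ?_, hP, hPcard⟩, ?_⟩
  · rcases hcov with h | ⟨h, -⟩
    · exact h
    · exact absurd (h ▸ hΩ) (noncompact_univ Plane)
  · ext x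
    simp only [stepFun, MvPolynomial.eval_eq_of_totalDegree_lt_one (hdeg _)]

/-- Hölder's inequality for a sum supported on a finite set. -/
lemma sum_rpow_le_card_rpow_mul {ι : Type*} (T : Finset ι) {θ : ℝ} (hθ : 0 < θ) (hθ' : θ < 1)
    (x : ι → ℝ≥0∞) :
    ∑ q ∈ T, x q ^ θ ≤ (T.card : ℝ≥0∞) ^ (1 - θ) * (∑ q ∈ T, x q) ^ θ := by
  have hconj : (1 / θ).HolderConjugate (1 / (1 - θ)) := by
    rw [Real.holderConjugate_iff]
    refine ⟨by rw [lt_div_iff₀ hθ]; linarith, by simp⟩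
  have := ENNReal.inner_le_Lp_mul_Lq T (fun q => x q ^ θ) (fun _ => 1) hconj
  simp only [mul_one, ENNReal.one_rpow, Finset.sum_const, nsmul_eq_mul, one_div_one_div,
    ← ENNReal.rpow_mul, mul_one_div_cancel hθ.ne', ENNReal.rpow_one] at this
  rwa [mul_comm]

lemma IsTiling.besovSeminorm_le {C : ℝ} {N : ℕ} {Ω : Set Plane} {n : ℕ} {U V : Fin n → Set Plane}
    {P Q : Fin n → Finset Plane} (HU : IsTiling C N Ω U P) (HV : IsTiling C N Ω V Q)
    (hC : 0 < C) (hΩ : IsCompact Ω) {s τ : ℝ} (hs : 0 < s) (hτ : 1 ≤ τ) (hsτ : s * τ < 1)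
    (c d : Fin n → ℝ) :
    besovSeminorm Ω 1 s τ (stepFun U c) ≤ besovSeminorm Ω 1 s τ (stepFun V d) +
      2 * (ENNReal.ofReal (4 * N * timeConst ((2 * Real.pi + 1) * C) (s * τ)) *
        ∑ q : Fin n × Fin n, ‖c q.1 - d q.2‖ₑ ^ τ *
          volume (U q.1 ∩ V q.2) ^ (1 - s * τ / 2)) ^ (1 / τ) := by
  have hτ0 : 0 < τ := by linarith
  have hσ : 0 < s * τ := by positivity
  have hK : 0 ≤ (2 * Real.pi + 1) * C := by
    have := Real.pi_pos
    positivity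
  have hfin (q : Fin n × Fin n) : volume (U q.1 ∩ V q.2) ≠ ∞ := by
    refine measure_ne_top_of_subset ?_ hΩ.measure_ne_top
    exact inter_subset_left.trans (HU.iUnion_eq ▸ subset_iUnion U q.1)
  have hmin (q : Fin n × Fin n) : Measurable fun t : ℝ => min (volume (U q.1 ∩ V q.2))
        (ENNReal.ofReal ((2 * Real.pi + 1) * C * t) *
          volume (U q.1 ∩ V q.2) ^ (1 / 2 : ℝ)) := by
    fun_prop
  refine (besovSeminorm_le_add hτ (Finset.measurable_sum _ fun q _ =>
    ((hmin q).const_mul _).const_mul _) (HU.modulus_le HV hC hΩ hτ c d)).trans ?_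
  gcongr
  simp only [Finset.mul_sum]
  rw [lintegral_finsetSum _ fun q _ => by
    have := hmin q
    fun_prop]
  gcongr with q
  have hcomm : ∀ t : ℝ, ENNReal.ofReal (t ^ (-(s * τ) - 1)) * (‖c q.1 - d q.2‖ₑ ^ τ * (4 * N *
      min (volume (U q.1 ∩ V q.2)) (ENNReal.ofReal ((2 * Real.pi + 1) * C * t) *
          volume (U q.1 ∩ V q.2) ^ (1 / 2 : ℝ)))) = ‖c q.1 - d q.2‖ₑ ^ τ * (4 * N) *
      (ENNReal.ofReal (t ^ (-(s * τ) - 1)) * min (volume (U q.1 ∩ V q.2))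
        (ENNReal.ofReal ((2 * Real.pi + 1) * C * t) *
          volume (U q.1 ∩ V q.2) ^ (1 / 2 : ℝ))) := fun t => by ring
  simp only [hcomm]
  rw [lintegral_const_mul _ (by
    have := hmin q
    fun_prop)]
  calc _ ≤ ‖c q.1 - d q.2‖ₑ ^ τ * (4 * N) *
        (ENNReal.ofReal (timeConst ((2 * Real.pi + 1) * C) (s * τ)) *
          volume (U q.1 ∩ V q.2) ^ (1 - s * τ / 2)) := by
        gcongr
        exact setLIntegral_rpow_mul_min_volume_le hK hσ hsτ (hfin q)
    _ = _ := by
        rw [ENNReal.ofReal_mul (by positivity), ENNReal.ofReal_mul (by positivity),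
          ENNReal.ofReal_natCast, ENNReal.ofReal_ofNat]
        ring

lemma IsTiling.sum_rpow_mul_volume_le {C : ℝ} {N : ℕ} {Ω : Set Plane} {n : ℕ}
    {U V : Fin n → Set Plane} {P Q : Fin n → Finset Plane} (HU : IsTiling C N Ω U P)
    (HV : IsTiling C N Ω V Q) {p τ M : ℝ} (hτ : 0 < τ) (hτp : τ < p)
    (hM : ((Finset.univ.filter fun q : Fin n × Fin n => (U q.1 ∩ V q.2).Nonempty).card : ℝ) ≤ M)
    (c d : Fin n → ℝ) :
    ∑ q : Fin n × Fin n, ‖c q.1 - d q.2‖ₑ ^ τ * volume (U q.1 ∩ V q.2) ^ (τ / p) ≤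
      ENNReal.ofReal M ^ (1 - τ / p) *
        lpNormE p Ω (fun x => stepFun U c x - stepFun V d x) ^ τ := by
  have hp : 0 < p := hτ.trans hτp
  have hθ : 0 < τ / p := by positivity
  set T := Finset.univ.filter fun q : Fin n × Fin n => (U q.1 ∩ V q.2).Nonempty
  calc _ = ∑ q ∈ T, (‖c q.1 - d q.2‖ₑ ^ p * volume (U q.1 ∩ V q.2)) ^ (τ / p) := by
        symm
        refine (Finset.sum_subset (Finset.subset_univ T) fun q _ hq => ?_).trans ?_
        · have : U q.1 ∩ V q.2 = ∅ := by
            simpa [T, not_nonempty_iff_eq_empty] using hq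
          simp [this, hθ]
        · refine Finset.sum_congr rfl fun q _ => ?_
          rw [ENNReal.mul_rpow_of_nonneg _ _ hθ.le, ← ENNReal.rpow_mul, mul_div_cancel₀ _ hp.ne']
    _ ≤ (T.card : ℝ≥0∞) ^ (1 - τ / p) *
        (∑ q ∈ T, ‖c q.1 - d q.2‖ₑ ^ p * volume (U q.1 ∩ V q.2)) ^ (τ / p) :=
        sum_rpow_le_card_rpow_mul T hθ ((div_lt_one hp).2 hτp) _
    _ ≤ ENNReal.ofReal M ^ (1 - τ / p) *
        (∫⁻ x in Ω, ‖stepFun U c x - stepFun V d x‖ₑ ^ p) ^ (τ / p) := by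
        have : 0 ≤ 1 - τ / p := sub_nonneg.2 ((div_le_one hp).2 hτp.le)
        gcongr
        · rw [← ENNReal.ofReal_natCast]
          exact ENNReal.ofReal_le_ofReal hM
        · exact (Finset.sum_le_sum_of_subset (Finset.subset_univ T)).trans
            (HU.sum_mul_volume_le HV c d)
    _ = _ := by
        rw [lpNormE_rpow_eq hp, ← ENNReal.rpow_mul]
        congr 2
        ring

theorem bernstein_diff_piecewise_constants_tau_ge_one (N₀ : ℕ) (c₀ β : ℝ) (hc₀ : 1 ≤ c₀) (hβ : 0 < β) (hβ' : β ≤ Real.pi / 3)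
    (p s τ : ℝ) (hp : 0 < p) (hs : 0 < s) (hs2 : s < 2 / p) (hτ : 1 / τ = s / 2 + 1 / p)
    (hτ1 : 1 ≤ τ) :
    ∃ c : ℝ, 0 < c ∧
      ∀ (Ω : Set Plane) (n₀ : ℕ), IsCompact Ω → IsRingDecomp N₀ c₀ β n₀ Ω →
        ∀ n : ℕ, n₀ ≤ n → ∀ S₁ S₂ : Plane → ℝ,
          IsSpline N₀ c₀ β n 1 Ω S₁ → IsSpline N₀ c₀ β n 1 Ω S₂ →
          besovSeminorm Ω 1 s τ S₁ ≤
            besovSeminorm Ω 1 s τ S₂ +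
              ENNReal.ofReal (c * (n : ℝ) ^ (s / 2)) *
                lpNormE p Ω (fun x => S₁ x - S₂ x) := by
  have hτ0 : 0 < τ := by linarith
  have hinv : 1 / p < 1 / τ := by rw [hτ]; linarith
  have hτp : τ < p := (one_div_lt_one_div hp hτ0).1 hinv
  have hmul : s * τ / 2 + τ / p = 1 := by
    have : τ * (s / 2 + 1 / p) = 1 := by rw [← hτ, mul_one_div_cancel hτ0.ne']
    rw [← this]
    ring
  have hsτ : s * τ < 1 := by
    have : s / 2 * τ < 1 / p * τ := by
      refine mul_lt_mul_of_pos_right ?_ hτ0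
      rw [div_lt_iff₀ two_pos]
      calc s < 2 / p := hs2
        _ = 1 / p * 2 := by ring
    have h2 : 1 / p * τ = τ / p := by ring
    have h3 : s / 2 * τ = s * τ / 2 := by ring
    linarith
  have hC := cornerConst_pos hβ hβ'
  have hK : 0 ≤ (2 * Real.pi + 1) * cornerConst β := by
    have := Real.pi_pos
    positivity
  set κ : ℝ := 4 * ((8 * N₀ : ℕ) : ℝ) *
    timeConst ((2 * Real.pi + 1) * cornerConst β) (s * τ)
  have hκ0 : 0 ≤ κ := by
    have := timeConst_pos hK (mul_pos hs hτ0) hsτ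
    positivity
  set m : ℝ := 2 * ringOverlap N₀ c₀ β
  have hm0 : 0 ≤ m := by
    have : 0 ≤ ringOverlap N₀ c₀ β := sq_nonneg _
    positivity
  refine ⟨2 * κ ^ (1 / τ) * m ^ (s / 2) + 1, by positivity, ?_⟩
  intro Ω n₀ hΩ _ n _ S₁ S₂ hS₁ hS₂
  obtain ⟨U, P, c, hU, hdU, HU, rfl⟩ := hS₁.exists_tiling hβ hβ' hΩ
  obtain ⟨V, Q, d, hV, hdV, HV, rfl⟩ := hS₂.exists_tiling hβ hβ' hΩ
  have hcard := card_inter_pairs_le hβ hβ' hc₀ U V hU hV hdU hdV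
  refine (HU.besovSeminorm_le HV hC hΩ hs hτ1 hsτ c d).trans (add_le_add le_rfl ?_)
  have hexp : 1 - s * τ / 2 = τ / p := by linarith
  have hexp' : (1 - τ / p) * (1 / τ) = s / 2 := by
    rw [show 1 - τ / p = s / 2 * τ by linarith, mul_assoc, mul_one_div_cancel hτ0.ne', mul_one]
  rw [hexp]
  calc _ ≤ 2 * (ENNReal.ofReal κ * (ENNReal.ofReal (m * n) ^ (1 - τ / p) *
        lpNormE p Ω (fun x => stepFun U c x - stepFun V d x) ^ τ)) ^ (1 / τ) := by
        gcongr
        exact HU.sum_rpow_mul_volume_le HV hτ0 hτp hcard c d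
    _ = ENNReal.ofReal (2 * κ ^ (1 / τ) * m ^ (s / 2) * (n : ℝ) ^ (s / 2)) *
        lpNormE p Ω (fun x => stepFun U c x - stepFun V d x) := by
        have h0 : 0 ≤ 1 / τ := by positivity
        rw [ENNReal.mul_rpow_of_nonneg _ _ h0, ENNReal.mul_rpow_of_nonneg _ _ h0,
          ← ENNReal.rpow_mul, ← ENNReal.rpow_mul, hexp', mul_one_div_cancel hτ0.ne',
          ENNReal.rpow_one, ENNReal.ofReal_rpow_of_nonneg hκ0 h0,
          ENNReal.ofReal_rpow_of_nonneg (by positivity) (by positivity),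
          Real.mul_rpow hm0 (by positivity), ← mul_assoc, ← mul_assoc,
          ← ENNReal.ofReal_ofNat 2, ← ENNReal.ofReal_mul two_pos.le,
          ← ENNReal.ofReal_mul (by positivity)]
        congr 2
        ring
    _ ≤ _ := by
        gcongr
        linarith

end
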